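/- arXiv:1609.05219 — 4 statements merged into one kernel-verified Lean document; each statement's English description precedes it below -/
import Mathlib

section
/- Let n ≥ 2 and let w₁ < w₂ < ⋯ < w_{n−1} be real numbers. Let S be the set of normalized real polynomials P of degree n whose ramification type at each w_j is (2,1,…,1) (i.e., every w_j is a simple branch point). Then every P ∈ S has exactly n−1 critical points, all real and distinct, say x₁ < x₂ < ⋯ < x_{n−1}, and the map sending P to the permutation σ of {1,…,n−1} determined by P(xᵢ) = w_{σ(i)} is a bijection from S onto the set of alternating permutations: those σ satisfying σ(1) < σ(2) > σ(3) < σ(4) > ⋯ if n is even, and σ(1) > σ(2) < σ(3) > σ(4) < ⋯ if n is odd. In particular, the cardinality of S equals the number of such alternating permutations of {1,…,n−1}. -/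
open Polynomial
open scoped Classical

/-- The ramification type of `w` for a real polynomial `P`: the multiset of
multiplicities of the complex roots of `P - w`. -/
noncomputable def ramType (P : Polynomial ℝ) (w : ℝ) : Multiset ℕ :=
  ((P.map (algebraMap ℝ ℂ) - Polynomial.C (w : ℂ)).roots.toFinset.val).map
    fun z => (P.map (algebraMap ℝ ℂ) - Polynomial.C (w : ℂ)).rootMultiplicity z

/-- A disorder of `P`: a pair `x₁ < x₂` with `P x₁ = P x₂` and the multiplicity of `x₁`
as a root of `P - P x₁` strictly greater than that of `x₂`. -/
def disorders (P : Polynomial ℝ) : Set (ℝ × ℝ) :=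
  {p | p.1 < p.2 ∧ P.eval p.1 = P.eval p.2 ∧
    (P - Polynomial.C (P.eval p.2)).rootMultiplicity p.2
      < (P - Polynomial.C (P.eval p.1)).rootMultiplicity p.1}

/-- The sign `ε(P) = (-1)^{number of disorders}`. -/
noncomputable def epsilonP (P : Polynomial ℝ) : ℤ := (-1) ^ Nat.card (disorders P)

/-- `P = X^n + a₂ X^(n-2) + ⋯ + a_n`: monic of degree `n` with vanishing coefficient
of `X^(n-1)`. -/
def IsNormalized (n : ℕ) (P : Polynomial ℝ) : Prop :=
  P.natDegree = n ∧ P.Monic ∧ P.coeff (n - 1) = 0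

/-- A multiset of positive integers summing to `n`. -/
def IsPartitionOf (n : ℕ) (Λ : Multiset ℕ) : Prop := Λ.sum = n ∧ 0 ∉ Λ

/-- The set of normalized real degree-`n` polynomials all of whose `n-1` branch points
`w 0 < w 1 < ⋯ < w (n-2)` are simple, i.e. have ramification type `(2,1,…,1)`. -/
noncomputable def simpleSet (n : ℕ) (w : Fin (n - 1) → ℝ) : Set (Polynomial ℝ) :=
  {P | IsNormalized n P ∧
    ∀ j, ramType P (w j) = 2 ::ₘ Multiset.replicate (n - 2) 1}

/-- A permutation `σ` of `{0,…,n-2}` is alternating (in the sense relevant for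
degree-`n` polynomials): `σ 0 < σ 1 > σ 2 < ⋯` if `n` is even, and
`σ 0 > σ 1 < σ 2 > ⋯` if `n` is odd. -/
def IsAlternating (n : ℕ) (σ : Equiv.Perm (Fin (n - 1))) : Prop :=
  ∀ i : Fin (n - 1), ∀ hi : (i : ℕ) + 1 < n - 1,
    if Even n then
      (Even (i : ℕ) → σ i < σ ⟨(i : ℕ) + 1, hi⟩) ∧
        (Odd (i : ℕ) → σ ⟨(i : ℕ) + 1, hi⟩ < σ i)
    else
      (Even (i : ℕ) → σ ⟨(i : ℕ) + 1, hi⟩ < σ i) ∧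
        (Odd (i : ℕ) → σ i < σ ⟨(i : ℕ) + 1, hi⟩)


theorem bij_of_proper_local {E : Type*} [NormedAddCommGroup E] [NormedSpace ℝ E]
    [FiniteDimensional ℝ E] {S T : Set E} (hSo : IsOpen S) (hSc : Convex ℝ S)
    (hSn : S.Nonempty) (hTo : IsOpen T) (hTc : Convex ℝ T) (f : E → E) (hf : ContDiff ℝ 1 f)
    (hmap : Set.MapsTo f S T)
    (hder : ∀ x ∈ S, ∀ d, fderiv ℝ f x d = 0 → d = 0)
    (hprop : ∀ K ⊆ T, IsCompact K → ∃ C ⊆ S, IsCompact C ∧ ∀ x ∈ S, f x ∈ K → x ∈ C) :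
    Set.BijOn f S T := by
  obtain ⟨x₀, hx₀⟩ := hSn
  let g : S → T := hmap.restrict f S T
  have hgc : Continuous g := hf.continuous.continuousOn.mapsToRestrict hmap
  have : Nonempty S := ⟨⟨x₀, hx₀⟩⟩
  have : Nonempty T := ⟨g ⟨x₀, hx₀⟩⟩
  have hS_emb : Topology.IsOpenEmbedding (Subtype.val : S → E) := hSo.isOpenEmbedding_subtypeVal
  have hT_emb : Topology.IsOpenEmbedding (Subtype.val : T → E) := hTo.isOpenEmbedding_subtypeVal
  have : LocallyCompactSpace T := hTo.locallyCompactSpace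
  have hproper : IsProperMap g := by
    rw [isProperMap_iff_isCompact_preimage]
    refine ⟨hgc, fun K hK => ?_⟩
    obtain ⟨C, hCS, hC, hCx⟩ := hprop (Subtype.val '' K) (by rintro _ ⟨y, _, rfl⟩; exact y.2)
      (hK.image continuous_subtype_val)
    have hC' : IsCompact (Subtype.val ⁻¹' C : Set S) := by
      rw [Topology.IsEmbedding.subtypeVal.isCompact_iff]
      rwa [Subtype.image_preimage_coe, Set.inter_eq_right.2 hCS]
    refine hC'.of_isClosed_subset (hK.isClosed.preimage hgc) ?_
    intro x hx
    exact hCx x.1 x.2 ⟨g x, hx, rfl⟩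
  have hloc : IsLocalHomeomorph g := by
    have h1 : IsLocalHomeomorph (Subtype.val ∘ g) := by
      have : (Subtype.val ∘ g) = f ∘ (Subtype.val : S → E) := by ext x; rfl
      rw [this]
      have h2 : IsLocalHomeomorphOn f S := by
        intro x hx
        have hinj : LinearMap.ker ((fderiv ℝ f x : E →L[ℝ] E) : E →ₗ[ℝ] E) = ⊥ :=
          LinearMap.ker_eq_bot'.2 (fun d hd => hder x hx d hd)
        let L : E ≃L[ℝ] E := (LinearEquiv.ofInjectiveEndo _ (LinearMap.ker_eq_bot.1 hinj)).toContinuousLinearEquiv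
        have hL : (L : E →L[ℝ] E) = fderiv ℝ f x := by ext d; rfl
        have h3 : HasStrictFDerivAt f (L : E →L[ℝ] E) x := by
          rw [hL]; exact hf.contDiffAt.hasStrictFDerivAt (by simp)
        exact ⟨h3.toOpenPartialHomeomorph f, h3.mem_toOpenPartialHomeomorph_source, rfl⟩
      rw [isLocalHomeomorph_iff_isLocalHomeomorphOn_univ]
      exact h2.comp (hS_emb.isLocalHomeomorph.isLocalHomeomorphOn) (fun x _ => x.2)
    exact h1.of_comp hT_emb.isLocalHomeomorph hgc
  have hcov : IsCoveringMap g := by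
    rw [isCoveringMap_iff_isCoveringMapOn_univ]
    refine hproper.isClosedMap.isCoveringMapOn_of_isLocalHomeomorphOn ?_ ?_
    · intro y _
      refine (hproper.isCompact_preimage isCompact_singleton).finite ?_
      exact IsDiscrete.of_openPartialHomeomorph g subset_rfl
        (fun e _ => by obtain ⟨φ, h, h'⟩ := hloc e; exact ⟨φ, h, h'.symm⟩)
    · exact (isLocalHomeomorph_iff_isLocalHomeomorphOn_univ.1 hloc).mono (Set.subset_univ _)
  have : ContractibleSpace T := hTc.contractibleSpace ⟨_, hmap hx₀⟩
  have : LocallyPathConnectedSpace T := hTo.locallyPathConnectedSpace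
  have : PreconnectedSpace S := isPreconnected_iff_preconnectedSpace.1 hSc.isPreconnected
  obtain ⟨F, ⟨hF0, hF⟩, -⟩ := hcov.existsUnique_continuousMap_lifts (ContinuousMap.id T)
    (g ⟨x₀, hx₀⟩) ⟨x₀, hx₀⟩ rfl
  have hFg : F ∘ g = id := by
    refine hcov.eq_of_comp_eq (F.continuous.comp hgc) continuous_id ?_ ⟨x₀, hx₀⟩ hF0
    rw [← Function.comp_assoc, hF]; rfl
  refine ⟨hmap, ?_, ?_⟩
  · intro a ha b hb hab
    have h1 := congrFun hFg ⟨a, ha⟩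
    have h2 := congrFun hFg ⟨b, hb⟩
    have : g ⟨a, ha⟩ = g ⟨b, hb⟩ := Subtype.ext hab
    simp only [Function.comp, this, id] at h1 h2
    exact congrArg Subtype.val (h1.symm.trans h2)
  · intro y hy
    refine ⟨F ⟨y, hy⟩, (F ⟨y, hy⟩).2, ?_⟩
    exact congrArg Subtype.val (congrFun hF ⟨y, hy⟩)


/-- `(k+2) ∏ (X - x_j)`. -/
noncomputable def cpoly {k : ℕ} (x : Fin (k + 1) → ℝ) : ℝ[X] :=
  C ((k : ℝ) + 2) * ∏ j, (X - C (x j))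

/-- Formal antiderivative (of polynomials of degree `≤ k+1`). -/
noncomputable def anti (k : ℕ) (p : ℝ[X]) : ℝ[X] :=
  ∑ i ∈ Finset.range (k + 2), C (p.coeff i / ((i : ℝ) + 1)) * X ^ (i + 1)

theorem anti_deriv (k : ℕ) (p : ℝ[X]) (hp : p.natDegree ≤ k + 1) : derivative (anti k p) = p := by
  conv_rhs => rw [p.as_sum_range_C_mul_X_pow' (n := k + 2) (by omega)]
  unfold anti
  rw [derivative_sum]
  refine Finset.sum_congr rfl fun i _ => ?_
  rw [derivative_C_mul_X_pow]
  have : (i : ℝ) + 1 ≠ 0 := by positivity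
  simp only [Nat.cast_add, Nat.cast_one, Nat.add_sub_cancel]
  rw [div_mul_cancel₀ _ this]

theorem anti_eval (k : ℕ) (p : ℝ[X]) (s : ℝ) :
    (anti k p).eval s = ∑ i ∈ Finset.range (k + 2), p.coeff i / ((i : ℝ) + 1) * s ^ (i + 1) := by
  simp [anti, eval_finsetSum]

theorem anti_coeff (k : ℕ) (p : ℝ[X]) (i : ℕ) (hi : i < k + 2) :
    (anti k p).coeff (i + 1) = p.coeff i / ((i : ℝ) + 1) := by
  simp only [anti, finsetSum_coeff, coeff_C_mul, coeff_X_pow]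
  rw [Finset.sum_eq_single i]
  · simp
  · intro b _ hb
    simp [hb.symm]
  · intro h; exact absurd (Finset.mem_range.2 hi) h

theorem anti_natDegree (k : ℕ) (p : ℝ[X]) : (anti k p).natDegree ≤ k + 2 := by
  refine natDegree_sum_le_of_forall_le _ _ fun i hi => ?_
  refine (natDegree_C_mul_X_pow_le _ _).trans ?_
  have := Finset.mem_range.1 hi
  omega

theorem cpoly_natDegree {k : ℕ} (x : Fin (k + 1) → ℝ) : (cpoly x).natDegree = k + 1 := by
  have h : (k : ℝ) + 2 ≠ 0 := by positivity
  rw [cpoly, natDegree_C_mul h, natDegree_finsetProd_X_sub_C_eq_card]; simp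

theorem cpoly_eval {k : ℕ} (x : Fin (k + 1) → ℝ) (t : ℝ) :
    (cpoly x).eval t = ((k : ℝ) + 2) * ∏ j, (t - x j) := by
  simp [cpoly, eval_prod]

/-- product of polynomial families with `C^1` coefficients. -/
theorem contDiff_coeff_prod {E : Type*} [NormedAddCommGroup E] [NormedSpace ℝ E] {ι : Type*}
    (s : Finset ι) (p : ι → E → ℝ[X]) (hp : ∀ j i, ContDiff ℝ 1 (fun x => (p j x).coeff i)) :
    ∀ i, ContDiff ℝ 1 (fun x => (∏ j ∈ s, p j x).coeff i) := by
  induction s using Finset.induction_on with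
  | empty => intro i; simp only [Finset.prod_empty]; exact contDiff_const
  | insert a s ha ih =>
    intro i
    simp only [Finset.prod_insert ha, coeff_mul]
    exact ContDiff.sum fun q _ => (hp a q.1).mul (ih q.2)

theorem contDiff_cpoly_coeff {k : ℕ} (i : ℕ) :
    ContDiff ℝ 1 (fun x : Fin (k + 1) → ℝ => (cpoly x).coeff i) := by
  simp only [cpoly, coeff_C_mul]
  refine contDiff_const.mul (contDiff_coeff_prod _ (fun j (x : Fin (k + 1) → ℝ) => X - C (x j)) ?_ i)
  intro j i
  simp only [coeff_sub, coeff_C]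
  refine contDiff_const.sub ?_
  by_cases h : i = 0
  · simp only [h, if_true]; fun_prop
  · simp only [h, if_false]; fun_prop

/-- derivative of a product of linear polynomials, coefficientwise. -/
theorem hasDerivAt_coeff_prod {ι : Type*} [DecidableEq ι] (s : Finset ι) (x d : ι → ℝ) :
    ∀ i, HasDerivAt (fun t : ℝ => (∏ j ∈ s, (X - C (x j + t * d j))).coeff i)
      ((∑ a ∈ s, C (-d a) * ∏ j ∈ s.erase a, (X - C (x j))).coeff i) 0 := by
  induction s using Finset.induction_on with
  | empty => intro i; simp only [Finset.prod_empty, Finset.sum_empty, coeff_zero]; exact hasDerivAt_const _ _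
  | insert a s ha ih =>
    intro i
    have e : (∑ b ∈ insert a s, C (-d b) * ∏ j ∈ (insert a s).erase b, (X - C (x j)))
        = C (-d a) * ∏ j ∈ s, (X - C (x j)) + (X - C (x a)) *
          ∑ b ∈ s, C (-d b) * ∏ j ∈ s.erase b, (X - C (x j)) := by
      rw [Finset.sum_insert ha, Finset.erase_insert ha, Finset.mul_sum]
      congr 1
      refine Finset.sum_congr rfl fun b hb => ?_
      rw [Finset.erase_insert_of_ne (by rintro rfl; exact ha hb), Finset.prod_insert (by simp [ha])]
      ring
    rw [e, coeff_add, coeff_mul, coeff_mul, ← Finset.sum_add_distrib]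
    simp only [Finset.prod_insert ha, coeff_mul]
    refine HasDerivAt.fun_sum fun q _ => ?_
    have h1 : HasDerivAt (fun t : ℝ => (X - C (x a + t * d a)).coeff q.1) ((C (-d a)).coeff q.1) 0 := by
      simp only [coeff_sub, coeff_C]
      by_cases h : q.1 = 0
      · simp only [h, if_true]
        simpa using (((hasDerivAt_id (0 : ℝ)).mul_const (d a)).const_add (x a)).const_sub ((X : ℝ[X]).coeff 0)
      · simp only [h, if_false]; exact hasDerivAt_const _ _
    refine (h1.fun_mul (ih q.2)).congr_deriv ?_
    simp only [zero_mul, add_zero]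

/-- Variation of `cpoly`. -/
noncomputable def vpoly {k : ℕ} (x d : Fin (k + 1) → ℝ) : ℝ[X] :=
  C ((k : ℝ) + 2) * ∑ a, C (-d a) * ∏ j ∈ Finset.univ.erase a, (X - C (x j))

theorem hasDerivAt_anti {k : ℕ} (x d : Fin (k + 1) → ℝ) (a : Fin (k + 1)) :
    HasDerivAt (fun t : ℝ => (anti k (cpoly (x + t • d))).eval ((x + t • d) a))
      ((anti k (vpoly x d)).eval (x a) + d a * (cpoly x).eval (x a)) 0 := by
  have hc : ∀ i, HasDerivAt (fun t : ℝ => (cpoly (x + t • d)).coeff i) ((vpoly x d).coeff i) 0 := by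
    intro i
    simp only [cpoly, vpoly, coeff_C_mul]
    exact (hasDerivAt_coeff_prod Finset.univ x d i).const_mul _
  have hs : HasDerivAt (fun t : ℝ => (x + t • d) a) (d a) 0 := by
    simpa using (((hasDerivAt_id (0 : ℝ)).mul_const (d a)).const_add (x a))
  have e : (cpoly x).eval (x a) = ∑ i ∈ Finset.range (k + 2), (cpoly x).coeff i * (x a) ^ i :=
    eval_eq_sum_range' (by rw [cpoly_natDegree]; omega) _
  simp only [anti_eval]
  rw [e, Finset.mul_sum, ← Finset.sum_add_distrib]
  refine HasDerivAt.fun_sum fun i _ => ?_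
  have := ((hc i).div_const ((i : ℝ) + 1)).mul (hs.pow (i + 1))
  refine this.congr_deriv ?_
  have : (i : ℝ) + 1 ≠ 0 := by positivity
  simp
  field_simp

/-- The main map. -/
noncomputable def Psi {k : ℕ} (x : Fin (k + 1) → ℝ) : Fin (k + 1) → ℝ := fun i =>
  if i = 0 then ∑ j, x j else (anti k (cpoly x)).eval (x i) - (anti k (cpoly x)).eval (x 0)

theorem contDiff_Psi {k : ℕ} : ContDiff ℝ 1 (Psi (k := k)) := by
  rw [contDiff_pi]
  intro i
  have h : ∀ a : Fin (k + 1), ContDiff ℝ 1 (fun x : Fin (k + 1) → ℝ => (anti k (cpoly x)).eval (x a)) := by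
    intro a
    simp only [anti_eval]
    refine ContDiff.sum fun i _ => ?_
    exact ((contDiff_cpoly_coeff i).div_const _).mul (ContDiff.pow (by fun_prop) _)
  unfold Psi
  by_cases hi : i = 0
  · simp only [hi, if_true]; fun_prop
  · simp only [hi, if_false]; exact (h i).sub (h 0)

theorem cpoly_eval_self {k : ℕ} (x : Fin (k + 1) → ℝ) (a : Fin (k + 1)) : (cpoly x).eval (x a) = 0 := by
  rw [cpoly_eval, Finset.prod_eq_zero (Finset.mem_univ a) (sub_self _), mul_zero]

theorem Psi_der {k : ℕ} (x : Fin (k + 1) → ℝ) (hx : StrictMono x) (d : Fin (k + 1) → ℝ)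
    (hd : fderiv ℝ Psi x d = 0) : d = 0 := by
  have hD : HasDerivAt (fun t : ℝ => Psi (x + t • d)) 0 0 := by
    have h1 : HasFDerivAt (Psi (k := k)) (fderiv ℝ Psi x) (x + (0 : ℝ) • d) := by
      simp only [zero_smul, add_zero]
      exact (contDiff_Psi.differentiable (by simp) x).hasFDerivAt
    have h2 : HasDerivAt (fun t : ℝ => x + t • d) d 0 := by
      simpa using ((hasDerivAt_id (0 : ℝ)).smul_const d).const_add x
    have := h1.comp_hasDerivAt (0 : ℝ) h2
    rwa [hd] at this
  rw [hasDerivAt_pi] at hD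
  have hsum : ∑ a, d a = 0 := by
    have h0 := hD 0
    simp only [Psi, if_true] at h0
    have h1 : HasDerivAt (fun t : ℝ => ∑ j, (x + t • d) j) (∑ a, d a) 0 := by
      refine HasDerivAt.fun_sum fun a _ => ?_
      simpa using (((hasDerivAt_id (0 : ℝ)).mul_const (d a)).const_add (x a))
    exact h1.unique h0
  have hev : ∀ a, (anti k (vpoly x d)).eval (x a) = (anti k (vpoly x d)).eval (x 0) := by
    intro a
    by_cases ha : a = 0
    · rw [ha]
    have h0 := hD a
    simp only [Psi, ha, if_false] at h0
    have h1 := (hasDerivAt_anti x d a).sub (hasDerivAt_anti x d 0)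
    have := h1.unique h0
    simp only [cpoly_eval_self, Pi.zero_apply] at this
    linarith
  have hvd : (vpoly x d).natDegree ≤ k := by
    refine (natDegree_C_mul_le _ _).trans ?_
    refine natDegree_sum_le_of_forall_le _ _ fun a _ => ?_
    refine (natDegree_C_mul_le _ _).trans ?_
    rw [natDegree_finsetProd_X_sub_C_eq_card]
    simp
  have hvc : (vpoly x d).coeff k = 0 := by
    simp only [vpoly, coeff_C_mul, finsetSum_coeff]
    have : ∀ a, (∏ j ∈ Finset.univ.erase a, (X - C (x j))).coeff k = 1 := by
      intro a
      have hm : (∏ j ∈ Finset.univ.erase a, (X - C (x j))).Monic := monic_prod_X_sub_C _ _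
      have := hm.coeff_natDegree
      rw [natDegree_finsetProd_X_sub_C_eq_card] at this
      simpa using this
    simp [this, hsum]
  have hA : (anti k (vpoly x d)) = C ((anti k (vpoly x d)).eval (x 0)) := by
    refine eq_of_degree_sub_lt_of_eval_index_eq (Finset.univ : Finset (Fin (k + 1))) (v := x)
      hx.injective.injOn ?_ ?_
    · rw [degree_lt_iff_coeff_zero]
      intro m hm
      simp only [Finset.card_univ, Fintype.card_fin] at hm
      obtain ⟨i, rfl⟩ : ∃ i, m = i + 1 := ⟨m - 1, by omega⟩
      rw [coeff_sub, coeff_C, if_neg (by omega), sub_zero]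
      by_cases hi : i < k + 2
      · rw [anti_coeff k _ i hi]
        have : (vpoly x d).coeff i = 0 := by
          rcases Nat.lt_or_ge k i with h | h
          · exact coeff_eq_zero_of_natDegree_lt (by omega)
          · rw [show i = k by omega]; exact hvc
        simp [this]
      · exact coeff_eq_zero_of_natDegree_lt (by have := anti_natDegree k (vpoly x d); omega)
    · intro a _
      rw [eval_C]; exact hev a
  have hv : vpoly x d = 0 := by
    rw [← anti_deriv k (vpoly x d) (by omega), hA, derivative_C]
  ext a
  have h := congrArg (eval (x a)) hv
  simp only [vpoly, eval_mul, eval_C, eval_finsetSum, eval_prod, eval_sub, eval_X, eval_zero] at h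
  rw [Finset.sum_eq_single a] at h
  · have h2 : ∏ j ∈ Finset.univ.erase a, (x a - x j) ≠ 0 := by
      rw [Finset.prod_ne_zero_iff]
      intro j hj
      exact sub_ne_zero.2 (fun h => (Finset.ne_of_mem_erase hj) (hx.injective h).symm)
    have h3 : (k : ℝ) + 2 ≠ 0 := by positivity
    simpa [h2, h3] using h
  · intro b _ hb
    rw [Finset.prod_eq_zero (i := a) (by simp [hb.symm]) (sub_self _), mul_zero]
  · simp


theorem fin_dich {k : ℕ} (i : Fin k) (j : Fin (k + 1)) : j ≤ i.castSucc ∨ i.succ ≤ j := by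
  rcases le_or_gt j i.castSucc with h | h
  · exact Or.inl h
  · exact Or.inr (Fin.castSucc_lt_iff_succ_le.1 h)

theorem sign_prod {k : ℕ} (x : Fin (k + 1) → ℝ) (hx : StrictMono x) (i : Fin k) (t : ℝ)
    (h1 : x i.castSucc ≤ t) (h2 : t ≤ x i.succ) :
    (-1 : ℝ) ^ (k - (i : ℕ)) * ∏ j, (t - x j) = ∏ j, |t - x j| := by
  have e : ∀ j, |t - x j| = (if i.castSucc < j then (-1 : ℝ) else 1) * (t - x j) := by
    intro j
    by_cases h : i.castSucc < j
    · have := hx.monotone (Fin.castSucc_lt_iff_succ_le.1 h)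
      rw [if_pos h, abs_of_nonpos (by linarith)]; ring
    · have := hx.monotone (not_lt.1 h)
      rw [if_neg h, abs_of_nonneg (by linarith)]; ring
  simp only [e, Finset.prod_mul_distrib]
  congr 1
  rw [Finset.prod_ite, Finset.prod_const, Finset.prod_const_one, mul_one]
  congr 1
  have : (Finset.univ.filter fun j => i.castSucc < j) = Finset.Ioi i.castSucc := by ext; simp
  rw [this, Fin.card_Ioi]; simp

theorem gap_bounds {k : ℕ} (x : Fin (k + 1) → ℝ) (hx : StrictMono x) (P : ℝ[X])
    (hP : derivative P = cpoly x) (i : Fin k) :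
    ((k : ℝ) + 2) * ((x i.succ - x i.castSucc) / 3) ^ (k + 2) ≤
      (-1 : ℝ) ^ (k - (i : ℕ)) * (P.eval (x i.succ) - P.eval (x i.castSucc)) ∧
    (-1 : ℝ) ^ (k - (i : ℕ)) * (P.eval (x i.succ) - P.eval (x i.castSucc)) ≤
      ((k : ℝ) + 2) * (x i.succ - x i.castSucc) * (x (Fin.last k) - x 0) ^ (k + 1) := by
  set a := x i.castSucc with ha
  set b := x i.succ with hb
  have hab : a < b := hx (Fin.castSucc_lt_succ)
  have key : ∀ p q, a ≤ p → p < q → q ≤ b → ∃ ξ, p < ξ ∧ ξ < q ∧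
      (-1 : ℝ) ^ (k - (i : ℕ)) * (P.eval q - P.eval p) =
        ((k : ℝ) + 2) * (∏ j, |ξ - x j|) * (q - p) := by
    intro p q hp hpq hq
    obtain ⟨ξ, hξ, hs⟩ := exists_hasDerivAt_eq_slope (fun t => P.eval t)
      (fun t => (derivative P).eval t) hpq P.continuous.continuousOn (fun t _ => P.hasDerivAt t)
    refine ⟨ξ, hξ.1, hξ.2, ?_⟩
    rw [eq_div_iff (by linarith), hP, cpoly_eval] at hs
    rw [← hs, ← sign_prod x hx i ξ (by linarith [hξ.1]) (by linarith [hξ.2])]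
    ring
  have hk : (0 : ℝ) < (k : ℝ) + 2 := by positivity
  constructor
  · obtain ⟨ξ₁, h11, h12, e1⟩ := key a (a + (b - a) / 3) le_rfl (by linarith) (by linarith)
    obtain ⟨ξ₂, h21, h22, e2⟩ := key (a + (b - a) / 3) (a + 2 * (b - a) / 3) (by linarith)
      (by linarith) (by linarith)
    obtain ⟨ξ₃, h31, h32, e3⟩ := key (a + 2 * (b - a) / 3) b (by linarith) (by linarith) le_rfl
    have p1 : 0 ≤ ((k : ℝ) + 2) * (∏ j, |ξ₁ - x j|) * (a + (b - a) / 3 - a) :=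
      mul_nonneg (mul_nonneg hk.le (Finset.prod_nonneg fun _ _ => abs_nonneg _)) (by linarith)
    have p3 : 0 ≤ ((k : ℝ) + 2) * (∏ j, |ξ₃ - x j|) * (b - (a + 2 * (b - a) / 3)) :=
      mul_nonneg (mul_nonneg hk.le (Finset.prod_nonneg fun _ _ => abs_nonneg _)) (by linarith)
    have p2 : ((b - a) / 3) ^ (k + 1) ≤ ∏ j, |ξ₂ - x j| := by
      have : ((b - a) / 3) ^ (k + 1) = ∏ _j : Fin (k + 1), ((b - a) / 3) := by
        rw [Finset.prod_const, Finset.card_univ, Fintype.card_fin]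
      rw [this]
      refine Finset.prod_le_prod (fun _ _ => by linarith) fun j _ => ?_
      rcases fin_dich i j with h | h
      · have := hx.monotone h
        exact le_trans (by linarith) (le_abs_self _)
      · have := hx.monotone h
        exact le_trans (by linarith) (neg_le_abs _)
    have p2' : ((k : ℝ) + 2) * ((b - a) / 3) ^ (k + 2) ≤
        ((k : ℝ) + 2) * (∏ j, |ξ₂ - x j|) * (a + 2 * (b - a) / 3 - (a + (b - a) / 3)) := by
      have e : a + 2 * (b - a) / 3 - (a + (b - a) / 3) = (b - a) / 3 := by ring
      rw [e, pow_succ, ← mul_assoc]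
      exact mul_le_mul_of_nonneg_right (mul_le_mul_of_nonneg_left p2 hk.le) (by linarith)
    nlinarith
  · obtain ⟨ξ, h1, h2, e⟩ := key a b le_rfl hab le_rfl
    rw [e]
    have p : ∏ j, |ξ - x j| ≤ (x (Fin.last k) - x 0) ^ (k + 1) := by
      have : (x (Fin.last k) - x 0) ^ (k + 1) = ∏ _j : Fin (k + 1), (x (Fin.last k) - x 0) := by simp
      rw [this]
      refine Finset.prod_le_prod (fun _ _ => abs_nonneg _) fun j _ => ?_
      have q1 := hx.monotone (Fin.zero_le j)
      have q2 := hx.monotone (Fin.le_last j)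
      have q3 := hx.monotone (Fin.zero_le i.castSucc)
      have q4 := hx.monotone (Fin.le_last i.succ)
      rw [abs_le]; constructor <;> linarith
    have := mul_le_mul_of_nonneg_left p (mul_nonneg hk.le (sub_nonneg.2 hab.le))
    nlinarith

theorem gap_pos {k : ℕ} (x : Fin (k + 1) → ℝ) (hx : StrictMono x) (P : ℝ[X])
    (hP : derivative P = cpoly x) (i : Fin k) :
    0 < (-1 : ℝ) ^ (k - (i : ℕ)) * (P.eval (x i.succ) - P.eval (x i.castSucc)) := by
  refine lt_of_lt_of_le ?_ (gap_bounds x hx P hP i).1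
  have : 0 < x i.succ - x i.castSucc := sub_pos.2 (hx Fin.castSucc_lt_succ)
  positivity

/-- signed gaps of a point of the target. -/
noncomputable def sgap {k : ℕ} (y : Fin (k + 1) → ℝ) (i : Fin k) : ℝ :=
  (-1 : ℝ) ^ (k - (i : ℕ)) * (y i.succ - (if i.castSucc = 0 then 0 else y i.castSucc))

theorem continuous_sgap {k : ℕ} (i : Fin k) : Continuous (fun y => sgap y i) := by
  unfold sgap
  by_cases h : i.castSucc = 0
  · simp only [h, if_true]; fun_prop
  · simp only [h, if_false]; fun_prop

theorem sgap_Psi {k : ℕ} (x : Fin (k + 1) → ℝ) (i : Fin k) : sgap (Psi x) i =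
    (-1 : ℝ) ^ (k - (i : ℕ)) * ((anti k (cpoly x)).eval (x i.succ) -
      (anti k (cpoly x)).eval (x i.castSucc)) := by
  unfold sgap Psi
  by_cases h : i.castSucc = 0
  · simp [h, Fin.succ_ne_zero]
  · simp [h, Fin.succ_ne_zero]

theorem Psi_proper {k : ℕ} (K : Set (Fin (k + 1) → ℝ)) (hKT : K ⊆ {y | ∀ i, 0 < sgap y i})
    (hK : IsCompact K) : ∃ D ⊆ {x : Fin (k + 1) → ℝ | StrictMono x}, IsCompact D ∧
      ∀ x ∈ {x : Fin (k + 1) → ℝ | StrictMono x}, Psi x ∈ K → x ∈ D := by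
  obtain ⟨R, hR⟩ : ∃ R, ∀ y ∈ K, |y 0| ≤ R :=
    hK.exists_bound_of_continuousOn (f := fun y => y 0) (by fun_prop)
  have hH : ∃ H, ∀ i, ∀ y ∈ K, sgap y i ≤ H := by
    have : ∀ i : Fin k, ∃ H, ∀ y ∈ K, |sgap y i| ≤ H := fun i =>
      hK.exists_bound_of_continuousOn (f := fun y => sgap y i) (continuous_sgap i).continuousOn
    choose H hH using this
    refine ⟨∑ i, |H i|, fun i y hy => ?_⟩
    refine (le_abs_self _).trans ((hH i y hy).trans ((le_abs_self _).trans ?_))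
    exact Finset.single_le_sum (f := fun i => |H i|) (fun _ _ => abs_nonneg _) (Finset.mem_univ i)
  obtain ⟨H, hH⟩ := hH
  have hη : ∃ η > 0, ∀ i, ∀ y ∈ K, η ≤ sgap y i := by
    have : ∀ i : Fin k, ∃ η > 0, ∀ y ∈ K, η ≤ sgap y i := by
      intro i
      rcases K.eq_empty_or_nonempty with h | h
      · exact ⟨1, one_pos, by simp [h]⟩
      · obtain ⟨y, hy, hm⟩ := hK.exists_isMinOn h (continuous_sgap i).continuousOn
        exact ⟨sgap y i, hKT hy i, fun z hz => hm hz⟩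
    choose η hη hη' using this
    rcases isEmpty_or_nonempty (Fin k) with h | h
    · exact ⟨1, one_pos, fun i => h.elim i⟩
    · obtain ⟨i₀, hi₀⟩ := Finite.exists_min η
      exact ⟨η i₀, hη i₀, fun i y hy => (hi₀ i).trans (hη' i y hy)⟩
  obtain ⟨η, hη, hη'⟩ := hη
  set U : ℝ := 3 * max 1 H with hU
  have hU0 : 0 < U := by have := le_max_left 1 H; linarith
  set W : ℝ := (k : ℝ) * U + 1 with hW
  have hW0 : 0 < W := by positivity
  set δ : ℝ := η / (((k : ℝ) + 2) * W ^ (k + 1)) with hδ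
  have hδ0 : 0 < δ := by positivity
  refine ⟨{x | ∀ i : Fin k, δ ≤ x i.succ - x i.castSucc} ∩ Metric.closedBall 0 (W + |R|), ?_, ?_, ?_⟩
  · rintro x ⟨hx, -⟩
    refine Fin.strictMono_iff_lt_succ.2 fun i => ?_
    have := hx i
    linarith
  · refine (isCompact_closedBall _ _).inter_left ?_
    simp only [Set.ofPred_forall]
    exact isClosed_iInter fun i => isClosed_le continuous_const (by fun_prop)
  · intro x hx hxK
    have hP := anti_deriv k (cpoly x) (cpoly_natDegree x).le
    have hb := fun i => gap_bounds x hx _ hP i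
    simp only [← sgap_Psi] at hb
    have hu : ∀ i : Fin k, x i.succ - x i.castSucc ≤ U := by
      intro i
      by_contra hc
      push Not at hc
      have h1 := (hb i).1
      have h2 := hH i _ hxK
      set u := x i.succ - x i.castSucc
      have h3 : max 1 H < u / 3 := by linarith
      have h4 : 1 < u / 3 := lt_of_le_of_lt (le_max_left _ _) h3
      have h5 : H < u / 3 := lt_of_le_of_lt (le_max_right _ _) h3
      have h6 : u / 3 ≤ (u / 3) ^ (k + 2) := le_self_pow₀ h4.le (by omega)
      have h7 : (0 : ℝ) ≤ k := Nat.cast_nonneg k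
      nlinarith
    have htel : ∀ j : Fin (k + 1), x j - x 0 ≤ (j : ℕ) * U := by
      intro j
      induction j using Fin.induction with
      | zero => simp
      | succ i ih =>
        have := hu i
        simp only [Fin.val_succ, Nat.cast_add, Nat.cast_one, Fin.val_castSucc] at ih ⊢
        linarith
    have hD : x (Fin.last k) - x 0 ≤ W := by
      have := htel (Fin.last k)
      simp only [Fin.val_last] at this
      linarith
    have hD0 : 0 ≤ x (Fin.last k) - x 0 := sub_nonneg.2 (hx.monotone (Fin.zero_le _))
    refine ⟨fun i => ?_, ?_⟩
    · have h1 := (hb i).2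
      have h2 := hη' i _ hxK
      have h3 : 0 < x i.succ - x i.castSucc := sub_pos.2 (hx Fin.castSucc_lt_succ)
      rw [hδ, div_le_iff₀ (by positivity)]
      have h4 := pow_le_pow_left₀ hD0 hD (k + 1)
      have h5 : ((k : ℝ) + 2) * (x i.succ - x i.castSucc) * (x (Fin.last k) - x 0) ^ (k + 1) ≤
        ((k : ℝ) + 2) * (x i.succ - x i.castSucc) * W ^ (k + 1) :=
        mul_le_mul_of_nonneg_left h4 (by positivity)
      linarith
    · rw [mem_closedBall_zero_iff, pi_norm_le_iff_of_nonneg (by positivity)]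
      intro j
      have hS : |∑ l, x l| ≤ |R| := by
        have := hR _ hxK
        simp only [Psi, if_true] at this
        exact this.trans (le_abs_self R)
      have e : ((k : ℝ) + 1) * x j = ∑ l, (x j - x l) + ∑ l, x l := by
        simp [Finset.sum_sub_distrib]
      have hs : |∑ l, (x j - x l)| ≤ ((k : ℝ) + 1) * W := by
        refine (Finset.abs_sum_le_sum_abs _ _).trans ?_
        have : ∀ l ∈ Finset.univ, |x j - x l| ≤ W := by
          intro l _
          have q1 := hx.monotone (Fin.zero_le j)
          have q2 := hx.monotone (Fin.le_last j)
          have q3 := hx.monotone (Fin.zero_le l)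
          have q4 := hx.monotone (Fin.le_last l)
          rw [abs_le]; constructor <;> linarith
        refine (Finset.sum_le_card_nsmul _ _ _ this).trans ?_
        simp
      have h7 : (0 : ℝ) ≤ k := Nat.cast_nonneg k
      have h8 : ((k : ℝ) + 1) * |x j| ≤ ((k : ℝ) + 1) * W + |R| := by
        rw [← abs_of_pos (show (0 : ℝ) < (k : ℝ) + 1 by positivity), ← abs_mul,
          abs_of_pos (show (0 : ℝ) < (k : ℝ) + 1 by positivity), e]
        exact (abs_add_le _ _).trans (add_le_add hs hS)
      rw [Real.norm_eq_abs]
      have h9 := abs_nonneg R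
      by_contra hc
      push Not at hc
      nlinarith

theorem Psi_bij (k : ℕ) : Set.BijOn (Psi (k := k)) {x | StrictMono x} {y | ∀ i, 0 < sgap y i} := by
  refine bij_of_proper_local ?_ ?_ ?_ ?_ ?_ Psi contDiff_Psi ?_ (fun x hx d hd => Psi_der x hx d hd)
    (fun K hK hKc => Psi_proper K hK hKc)
  · simp only [Fin.strictMono_iff_lt_succ, Set.ofPred_forall]
    exact isOpen_iInter_of_finite fun i => isOpen_lt (by fun_prop) (by fun_prop)
  · intro x hx y hy a b ha hb hab i j hij
    have h1 := hx hij
    have h2 := hy hij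
    simp only [Pi.add_apply, Pi.smul_apply, smul_eq_mul]
    rcases ha.eq_or_lt with h | h
    · subst h
      have : b = 1 := by linarith
      subst this
      linarith
    · nlinarith [mul_pos h (sub_pos.2 h1), mul_nonneg hb (sub_pos.2 h2).le]
  · exact ⟨fun i => (i : ℕ), fun i j h => by simpa using h⟩
  · simp only [Set.ofPred_forall]
    exact isOpen_iInter_of_finite fun i => isOpen_lt continuous_const (continuous_sgap i)
  · intro x hx y hy a b ha hb hab i
    have h1 := hx i
    have h2 := hy i
    have e : sgap (a • x + b • y) i = a * sgap x i + b * sgap y i := by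
      unfold sgap
      simp only [Pi.add_apply, Pi.smul_apply, smul_eq_mul]
      split_ifs <;> ring
    rw [e]
    rcases ha.eq_or_lt with h | h
    · subst h
      have : b = 1 := by linarith
      subst this
      linarith
    · nlinarith [mul_pos h h1, mul_nonneg hb h2.le]
  · intro x hx i
    rw [sgap_Psi]
    exact gap_pos x hx _ (anti_deriv k (cpoly x) (cpoly_natDegree x).le) i

theorem core {k : ℕ} (v : Fin (k + 1) → ℝ)
    (hv : ∀ i : Fin k, 0 < (-1 : ℝ) ^ (k - (i : ℕ)) * (v i.succ - v i.castSucc)) :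
    ∃ x : Fin (k + 1) → ℝ, StrictMono x ∧ ∑ j, x j = 0 ∧
      ∃ P : ℝ[X], derivative P = cpoly x ∧ ∀ i, P.eval (x i) = v i := by
  obtain ⟨x, hx, hxy⟩ := (Psi_bij k).surjOn (a := fun i => v i - v 0) (by
    intro i
    have e : sgap (fun i => v i - v 0) i = (-1 : ℝ) ^ (k - (i : ℕ)) * (v i.succ - v i.castSucc) := by
      unfold sgap
      by_cases h : i.castSucc = 0
      · simp [h]
      · simp [h]
    rw [e]; exact hv i)
  refine ⟨x, hx, ?_, anti k (cpoly x) + C (v 0 - (anti k (cpoly x)).eval (x 0)), ?_, ?_⟩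
  · have := congrFun hxy 0
    simpa [Psi] using this
  · rw [derivative_add, derivative_C, add_zero, anti_deriv k (cpoly x) (cpoly_natDegree x).le]
  · intro i
    rw [eval_add, eval_C]
    by_cases h : i = 0
    · rw [h]; ring
    · have := congrFun hxy i
      simp only [Psi, h, if_false] at this
      linarith

theorem poly_eq_of_deriv (P Q : ℝ[X]) (t : ℝ) (h : derivative P = derivative Q)
    (ht : P.eval t = Q.eval t) : P = Q := by
  have h1 : derivative (P - Q) = 0 := by rw [derivative_sub, h, sub_self]
  have h2 := derivative_eq_zero.1 h1
  rw [natDegree_eq_zero] at h2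
  obtain ⟨c, hc⟩ := h2
  have h3 := congrArg (eval t) hc
  rw [eval_C, eval_sub, ht, sub_self] at h3
  rw [h3, C_0] at hc
  exact sub_eq_zero.1 hc.symm

theorem core_unique {k : ℕ} (x x' : Fin (k + 1) → ℝ) (hx : StrictMono x) (hx' : StrictMono x')
    (h0 : ∑ j, x j = ∑ j, x' j) (P Q : ℝ[X]) (hP : derivative P = cpoly x)
    (hQ : derivative Q = cpoly x') (hPQ : ∀ i, P.eval (x i) = Q.eval (x' i)) : P = Q := by
  have hgen : ∀ (x : Fin (k + 1) → ℝ) (P : ℝ[X]), derivative P = cpoly x →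
      ∀ i, i ≠ 0 → Psi x i = P.eval (x i) - P.eval (x 0) := by
    intro x P hP i hi
    have hA := anti_deriv k (cpoly x) (cpoly_natDegree x).le
    have : P = anti k (cpoly x) + C (P.eval (x 0) - (anti k (cpoly x)).eval (x 0)) := by
      refine poly_eq_of_deriv _ _ (x 0) ?_ ?_
      · rw [hP, derivative_add, hA, derivative_C, add_zero]
      · rw [eval_add, eval_C]; ring
    have e := congrArg (eval (x i)) this
    rw [eval_add, eval_C] at e
    simp only [Psi, hi, if_false]
    linarith
  have hxx : x = x' := by
    refine (Psi_bij k).injOn hx hx' ?_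
    ext i
    by_cases hi : i = 0
    · simp only [Psi, hi, if_true]; exact h0
    · rw [hgen x P hP i hi, hgen x' Q hQ i hi, hPQ, hPQ]
  subst hxx
  exact poly_eq_of_deriv P Q (x 0) (hP.trans hQ.symm) (hPQ 0)


theorem cpoly_map_roots {k : ℕ} (x : Fin (k + 1) → ℝ) :
    ((cpoly x).map (algebraMap ℝ ℂ)).roots =
      Finset.univ.val.map (fun i : Fin (k + 1) => (x i : ℂ)) := by
  have h : ((k : ℂ) + 2) ≠ 0 := by exact_mod_cast (by omega : k + 2 ≠ 0)
  have e : (cpoly x).map (algebraMap ℝ ℂ) = C ((k : ℂ) + 2) *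
      (Multiset.map (fun a => X - C a)
        (Finset.univ.val.map (fun i : Fin (k + 1) => (x i : ℂ)))).prod := by
    rw [Multiset.map_map, cpoly, Polynomial.map_mul, Polynomial.map_prod, Polynomial.map_C]
    congr 1
    · simp
    · change _ = ∏ j : Fin (k + 1), (X - C (x j : ℂ))
      refine Finset.prod_congr rfl fun j _ => ?_
      simp
  rw [e, roots_C_mul _ h, roots_multiset_prod_X_sub_C]

theorem cpoly_inj {k : ℕ} (x x' : Fin (k + 1) → ℝ) (hx : StrictMono x) (hx' : StrictMono x')
    (h : cpoly x = cpoly x') : x = x' := by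
  refine (StrictMono.range_inj hx hx').1 ?_
  have hr : ∀ x : Fin (k + 1) → ℝ, Set.range x = {t | (cpoly x).eval t = 0} := by
    intro x
    ext t
    have : (k : ℝ) + 2 ≠ 0 := by positivity
    simp only [Set.mem_range, Set.mem_ofPred_eq, cpoly_eval, mul_eq_zero, this, false_or,
      Finset.prod_eq_zero_iff, Finset.mem_univ, true_and, sub_eq_zero]
    exact exists_congr fun a => eq_comm
  rw [hr, hr, h]

theorem map_sub_C (P : ℝ[X]) (w : ℝ) :
    P.map (algebraMap ℝ ℂ) - C (w : ℂ) = (P - C w).map (algebraMap ℝ ℂ) := by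
  simp

theorem eval_ofReal (P : ℝ[X]) (t : ℝ) : (P.map (algebraMap ℝ ℂ)).eval (t : ℂ) = ((P.eval t : ℝ) : ℂ) := by
  have := eval_map_apply (algebraMap ℝ ℂ) (p := P) t
  simpa using this

/-- sum of the critical points is zero iff normalized. -/
theorem coeff_of_deriv {k : ℕ} (x : Fin (k + 1) → ℝ) (P : ℝ[X]) (hP : derivative P = cpoly x) :
    P.natDegree = k + 2 ∧ P.Monic ∧ P.coeff (k + 1) * ((k : ℝ) + 1) = -((k : ℝ) + 2) * ∑ j, x j := by
  have hm : (∏ j, (X - C (x j))).Monic := monic_prod_X_sub_C _ _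
  have hc : ∀ i, P.coeff (i + 1) * ((i : ℝ) + 1) = (cpoly x).coeff i := by
    intro i; rw [← hP, coeff_derivative]
  have hd : P.natDegree = k + 2 := by
    have h1 := cpoly_natDegree x
    rw [← hP] at h1
    have h2 := natDegree_derivative P
    omega
  refine ⟨hd, ?_, ?_⟩
  · have h1 := hc (k + 1)
    have h2 : (cpoly x).coeff (k + 1) = (k : ℝ) + 2 := by
      have h3 := hm.coeff_natDegree
      rw [natDegree_finsetProd_X_sub_C_eq_card] at h3
      simp only [Finset.card_univ, Fintype.card_fin] at h3
      rw [cpoly, coeff_C_mul, h3, mul_one]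
    rw [h2] at h1
    have h4 : (k : ℝ) + 2 ≠ 0 := by positivity
    rw [Monic, leadingCoeff, hd]
    push_cast at h1
    have h5 : P.coeff (k + 2) * ((k : ℝ) + 2) = 1 * ((k : ℝ) + 2) := by linarith
    exact mul_right_cancel₀ h4 h5
  · rw [hc k, cpoly, coeff_C_mul]
    have h3 := prod_X_sub_C_coeff_card_pred (Finset.univ : Finset (Fin (k + 1))) x (by simp)
    simp only [Finset.card_univ, Fintype.card_fin, Nat.add_sub_cancel] at h3
    rw [h3]; ring

theorem simple_exists {k : ℕ} (w : Fin (k + 1) → ℝ) (hw : StrictMono w) (P : ℝ[X])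
    (hd : P.natDegree = k + 2) (hm : P.Monic)
    (hr : ∀ j, ramType P (w j) = 2 ::ₘ Multiset.replicate k 1) :
    ∃ (x : Fin (k + 1) → ℝ) (σ : Equiv.Perm (Fin (k + 1))), StrictMono x ∧
      derivative P = cpoly x ∧ ∀ i, P.eval (x i) = w (σ i) := by
  have hz : ∀ j, ∃ z : ℝ, P.eval z = w j ∧ (derivative P).eval z = 0 := by
    intro j
    have h := hr j
    unfold ramType at h
    set f := P.map (algebraMap ℝ ℂ) - C (w j : ℂ) with hf
    have hfr : f = (P - C (w j)).map (algebraMap ℝ ℂ) := map_sub_C P (w j)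
    have h2 : 2 ∈ (f.roots.toFinset.val).map fun z => f.rootMultiplicity z := by rw [h]; simp
    obtain ⟨z, hz, hz2⟩ := Multiset.mem_map.1 h2
    have hf0 : f ≠ 0 := by
      rintro h0
      rw [h0] at hz
      simp at hz
    have hconj : f.map (starRingEnd ℂ) = f := by
      rw [hfr, Polynomial.map_map]
      congr 1
      ext r
      simp
    have hz2' : f.rootMultiplicity (starRingEnd ℂ z) = 2 := by
      rw [← hz2]
      conv_lhs => rw [← hconj]
      exact (eq_rootMultiplicity_map (starRingEnd ℂ).injective z).symm
    have hzc : starRingEnd ℂ z = z := by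
      by_contra hne
      have hzm : starRingEnd ℂ z ∈ f.roots.toFinset := by
        rw [Multiset.mem_toFinset, mem_roots hf0, ← rootMultiplicity_pos hf0, hz2']; norm_num
      have hcard := congrArg (Multiset.count 2) h
      rw [Multiset.count_map, Multiset.count_cons_self, Multiset.count_replicate] at hcard
      simp only [show (1 : ℕ) ≠ 2 by norm_num, if_false, zero_add] at hcard
      have hsub : ({z, starRingEnd ℂ z} : Finset ℂ) ⊆ f.roots.toFinset.filter
          (fun a => 2 = f.rootMultiplicity a) := by
        intro a ha
        rw [Finset.mem_insert, Finset.mem_singleton] at ha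
        rw [Finset.mem_filter]
        rcases ha with rfl | rfl
        · exact ⟨hz, hz2.symm⟩
        · exact ⟨hzm, hz2'.symm⟩
      have := Finset.card_le_card hsub
      rw [Finset.card_pair (Ne.symm hne)] at this
      change 2 ≤ Multiset.card (Multiset.filter _ _) at this
      omega
    obtain ⟨r, rfl⟩ := Complex.conj_eq_iff_real.1 hzc
    have h3 := (one_lt_rootMultiplicity_iff_isRoot hf0).1 (by rw [hz2]; norm_num)
    refine ⟨r, ?_, ?_⟩
    · have := h3.1
      rw [hfr, IsRoot, eval_ofReal] at this
      simp only [eval_sub, eval_C] at this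
      have := Complex.ofReal_eq_zero.1 this
      linarith
    · have := h3.2
      rw [hfr, derivative_map, IsRoot, eval_ofReal] at this
      simp only [derivative_sub, derivative_C, sub_zero] at this
      exact Complex.ofReal_eq_zero.1 this
  choose z hz1 hz2 using hz
  have hzi : Function.Injective z := by
    intro a b hab
    apply hw.injective
    rw [← hz1 a, ← hz1 b, hab]
  have hPz : derivative P = cpoly z := by
    refine eq_of_degree_sub_lt_of_eval_index_eq (Finset.univ : Finset (Fin (k + 1))) (v := z)
      hzi.injOn ?_ ?_
    · rw [degree_lt_iff_coeff_zero]
      intro m hm'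
      simp only [Finset.card_univ, Fintype.card_fin] at hm'
      rw [coeff_sub, coeff_derivative]
      rcases Nat.lt_or_ge (k + 1) m with h | h
      · rw [coeff_eq_zero_of_natDegree_lt (by omega), coeff_eq_zero_of_natDegree_lt (by
          rw [cpoly_natDegree]; omega)]
        simp
      · obtain rfl : m = k + 1 := by omega
        have h1 : P.coeff (k + 1 + 1) = 1 := by
          have := hm.coeff_natDegree
          rwa [hd] at this
        have h2 : (∏ j, (X - C (z j))).coeff (k + 1) = 1 := by
          have h3 := (monic_prod_X_sub_C z Finset.univ).coeff_natDegree
          rw [natDegree_finsetProd_X_sub_C_eq_card] at h3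
          simpa using h3
        rw [h1, cpoly, coeff_C_mul, h2]
        push_cast; ring
    · intro a _
      rw [hz2, cpoly_eval_self]
  refine ⟨z ∘ Tuple.sort z, Tuple.sort z, ?_, ?_, fun i => hz1 _⟩
  · exact (Tuple.monotone_sort z).strictMono_of_injective (hzi.comp (Equiv.injective _))
  · rw [hPz, cpoly, cpoly]
    congr 1
    exact (Equiv.prod_comp (Tuple.sort z) (fun j => X - C (z j))).symm

theorem ramType_simple {k : ℕ} (x : Fin (k + 1) → ℝ) (hx : StrictMono x) (P : ℝ[X])
    (hP : derivative P = cpoly x) (hv : Function.Injective fun i => P.eval (x i)) (i : Fin (k + 1)) :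
    ramType P (P.eval (x i)) = 2 ::ₘ Multiset.replicate k 1 := by
  obtain ⟨hd, hm, -⟩ := coeff_of_deriv x P hP
  unfold ramType
  set f := P.map (algebraMap ℝ ℂ) - C ((P.eval (x i) : ℝ) : ℂ) with hf
  have hfr : f = (P - C (P.eval (x i))).map (algebraMap ℝ ℂ) := map_sub_C P _
  have hfd : f.natDegree = k + 2 := by
    rw [hfr, natDegree_map, natDegree_sub_C, hd]
  have hf0 : f ≠ 0 := by
    rintro h0
    rw [h0] at hfd
    simp at hfd
  have hder : derivative f = (cpoly x).map (algebraMap ℝ ℂ) := by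
    rw [hfr, derivative_map, derivative_sub, derivative_C, sub_zero, hP]
  have hder0 : derivative f ≠ 0 := by
    intro h0
    have h1 := derivative_eq_zero.1 h0
    omega
  have hroots : (derivative f).roots = Finset.univ.val.map (fun i : Fin (k + 1) => (x i : ℂ)) := by
    rw [hder, cpoly_map_roots]
  have hxi : f.IsRoot (x i : ℂ) := by
    rw [hfr, IsRoot, eval_ofReal]; simp
  have hcx : Function.Injective (fun i : Fin (k + 1) => (x i : ℂ)) :=
    Complex.ofReal_injective.comp hx.injective
  have hmi : f.rootMultiplicity (x i : ℂ) = 2 := by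
    have h1 := derivative_rootMultiplicity_of_root hxi
    have h2 : (derivative f).rootMultiplicity (x i : ℂ) = 1 := by
      rw [← count_roots, hroots]
      rw [Multiset.count_map_eq_count' _ _ hcx]
      simp
    omega
  have hother : ∀ z ∈ f.roots.toFinset, z ≠ (x i : ℂ) → f.rootMultiplicity z = 1 := by
    intro z hz hne
    rw [Multiset.mem_toFinset, mem_roots hf0] at hz
    have hpos := (rootMultiplicity_pos hf0).2 hz
    by_contra h1
    have h2 := (one_lt_rootMultiplicity_iff_isRoot hf0).1 (by omega : 1 < f.rootMultiplicity z)
    have h3 : z ∈ (derivative f).roots := (mem_roots hder0).2 h2.2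
    rw [hroots] at h3
    obtain ⟨l, -, rfl⟩ := Multiset.mem_map.1 h3
    apply hne
    have h4 := h2.1
    rw [hfr, IsRoot, eval_ofReal] at h4
    have h5 := Complex.ofReal_eq_zero.1 h4
    rw [eval_sub, eval_C, sub_eq_zero] at h5
    rw [hv h5]
  have hmem : (x i : ℂ) ∈ f.roots.toFinset := by
    rw [Multiset.mem_toFinset, mem_roots hf0]; exact hxi
  have hcard : ∑ z ∈ f.roots.toFinset, f.rootMultiplicity z = k + 2 := by
    rw [← hfd, ← (splits_iff_card_roots.1 (IsAlgClosed.splits f)),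
      ← Multiset.toFinset_sum_count_eq]
    exact Finset.sum_congr rfl fun z _ => (count_roots f).symm
  have hrest : ∀ z ∈ f.roots.toFinset.erase (x i : ℂ), f.rootMultiplicity z = 1 := fun z hz =>
    hother z (Finset.mem_of_mem_erase hz) (Finset.ne_of_mem_erase hz)
  have hc2 : (f.roots.toFinset.erase (x i : ℂ)).card = k := by
    rw [← Finset.add_sum_erase _ _ hmem, hmi, Finset.sum_congr rfl hrest] at hcard
    simp only [Finset.sum_const, smul_eq_mul, mul_one] at hcard
    omega
  have hins : f.roots.toFinset.val = (x i : ℂ) ::ₘ (f.roots.toFinset.erase (x i : ℂ)).val := by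
    rw [Finset.erase_val, Multiset.cons_erase hmem]
  rw [hins, Multiset.map_cons, hmi]
  congr 1
  rw [Multiset.eq_replicate]
  refine ⟨by rw [Multiset.card_map]; exact hc2, ?_⟩
  intro b hb
  obtain ⟨z, hz, rfl⟩ := Multiset.mem_map.1 hb
  exact hrest z hz

theorem alternating_iff {k : ℕ} (w : Fin (k + 1) → ℝ) (hw : StrictMono w)
    (σ : Equiv.Perm (Fin (k + 1))) : IsAlternating (k + 2) σ ↔
      ∀ i : Fin k, 0 < (-1 : ℝ) ^ (k - (i : ℕ)) * (w (σ i.succ) - w (σ i.castSucc)) := by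
  have key : ∀ i : Fin k, (0 < (-1 : ℝ) ^ (k - (i : ℕ)) * (w (σ i.succ) - w (σ i.castSucc)) ↔
      if Even (k + 2) then
      (Even (i : ℕ) → σ i.castSucc < σ i.succ) ∧ (Odd (i : ℕ) → σ i.succ < σ i.castSucc)
    else
      (Even (i : ℕ) → σ i.succ < σ i.castSucc) ∧ (Odd (i : ℕ) → σ i.castSucc < σ i.succ)) := by
    intro i
    have hi := i.2
    rcases Nat.even_or_odd k with hk | hk <;> rcases Nat.even_or_odd (i : ℕ) with hj | hj
    · have e : Even (k - (i : ℕ)) := by grind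
      have h1 : Even (k + 2) := by grind
      have h2 : ¬ Odd (i : ℕ) := by grind
      simp [e.neg_one_pow, h1, hj, hw.lt_iff_lt]
    · have e : Odd (k - (i : ℕ)) := by grind
      have h1 : Even (k + 2) := by grind
      have h2 : ¬ Even (i : ℕ) := by grind
      simp [e.neg_one_pow, h1, hj, hw.lt_iff_lt]
    · have e : Odd (k - (i : ℕ)) := by grind
      have h1 : ¬ Even (k + 2) := by grind
      have h2 : ¬ Odd (i : ℕ) := by grind
      simp [e.neg_one_pow, h1, hj, hw.lt_iff_lt]
    · have e : Even (k - (i : ℕ)) := by grind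
      have h1 : ¬ Even (k + 2) := by grind
      have h2 : ¬ Even (i : ℕ) := by grind
      simp [e.neg_one_pow, h1, hj, hw.lt_iff_lt]
  constructor
  · intro h i
    rw [key]
    exact h i.castSucc (by have := i.2; simp)
  · intro h i hi
    have hik : (i : ℕ) < k := by omega
    exact (key ⟨i, hik⟩).1 (h ⟨i, hik⟩)

theorem main_aux (k : ℕ) (w : Fin (k + 1) → ℝ) (hw : StrictMono w) :
    ∃ F : simpleSet (k + 2) w → {σ : Equiv.Perm (Fin (k + 1)) // IsAlternating (k + 2) σ},
      Function.Bijective F ∧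
      (∀ P : simpleSet (k + 2) w, ∃ x : Fin (k + 1) → ℝ, StrictMono x ∧
        (Polynomial.derivative ((P : Polynomial ℝ).map (algebraMap ℝ ℂ))).roots
          = Finset.univ.val.map (fun i : Fin (k + 1) => (x i : ℂ)) ∧
        ∀ i, (P : Polynomial ℝ).eval (x i) = w (((F P : Equiv.Perm (Fin (k + 1)))) i)) := by
  have hex : ∀ P : simpleSet (k + 2) w,
      ∃ (x : Fin (k + 1) → ℝ) (σ : Equiv.Perm (Fin (k + 1))), StrictMono x ∧
      derivative (P : ℝ[X]) = cpoly x ∧ (∀ i, (P : ℝ[X]).eval (x i) = w (σ i)) := by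
    rintro ⟨P, ⟨hd, hm, -⟩, hr⟩
    exact simple_exists w hw P hd hm hr
  choose x σ hx hP hv using hex
  have hσ : ∀ P, IsAlternating (k + 2) (σ P) := by
    intro P
    refine (alternating_iff w hw _).2 fun i => ?_
    rw [← hv, ← hv]
    exact gap_pos (x P) (hx P) _ (hP P) i
  have hsum : ∀ P, ∑ j, x P j = 0 := by
    intro P
    have h1 := (coeff_of_deriv (x P) _ (hP P)).2.2
    have h2 : (P : ℝ[X]).coeff (k + 1) = 0 := P.2.1.2.2
    rw [h2, zero_mul] at h1
    have h3 : -((k : ℝ) + 2) ≠ 0 := neg_ne_zero.2 (by positivity)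
    exact (mul_eq_zero.1 h1.symm).resolve_left h3
  refine ⟨fun P => ⟨σ P, hσ P⟩, ⟨?_, ?_⟩, ?_⟩
  · intro P Q hPQ
    have hPQ' : σ P = σ Q := congrArg Subtype.val hPQ
    apply Subtype.ext
    refine core_unique (x P) (x Q) (hx P) (hx Q) (by rw [hsum, hsum]) _ _ (hP P) (hP Q) fun i => ?_
    rw [hv, hv, hPQ']
  · rintro ⟨τ, hτ⟩
    obtain ⟨y, hy, hy0, P, hPy, hPv⟩ := core (fun i => w (τ i)) ((alternating_iff w hw τ).1 hτ)
    obtain ⟨hd, hm, hc⟩ := coeff_of_deriv y P hPy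
    have hPS : P ∈ simpleSet (k + 2) w := by
      refine ⟨⟨hd, hm, ?_⟩, fun j => ?_⟩
      · rw [hy0, mul_zero] at hc
        have h3 : (k : ℝ) + 1 ≠ 0 := by positivity
        exact (mul_eq_zero.1 hc).resolve_right h3
      · have h1 := ramType_simple y hy P hPy (by
          intro a b hab
          simp only [hPv] at hab
          exact τ.injective (hw.injective hab)) (τ.symm j)
        rw [hPv, Equiv.apply_symm_apply] at h1
        exact h1
    refine ⟨⟨P, hPS⟩, Subtype.ext ?_⟩
    have hxy : x ⟨P, hPS⟩ = y := cpoly_inj _ _ (hx _) hy ((hP ⟨P, hPS⟩).symm.trans hPy)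
    refine Equiv.ext fun i => hw.injective ?_
    change w (σ ⟨P, hPS⟩ i) = w (τ i)
    rw [← hv, hxy]
    exact hPv i
  · intro P
    refine ⟨x P, hx P, ?_, hv P⟩
    rw [derivative_map, hP, cpoly_map_roots]


/-- Real polynomials whose branch points are all real and simple are in bijection with
alternating permutations: every such `P` has `n-1` distinct real critical points
`x 0 < ⋯ < x (n-2)`, the permutation `σ` with `P (x i) = w (σ i)` is alternating, and
`P ↦ σ` is a bijection onto alternating permutations; in particular the cardinalities
agree. -/
theorem simple_polynomials_alternating_permutations (n : ℕ) (hn : 2 ≤ n)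
    (w : Fin (n - 1) → ℝ) (hw : StrictMono w) :
    ∃ F : simpleSet n w → {σ : Equiv.Perm (Fin (n - 1)) // IsAlternating n σ},
      Function.Bijective F ∧
      (∀ P : simpleSet n w, ∃ x : Fin (n - 1) → ℝ, StrictMono x ∧
        (Polynomial.derivative ((P : Polynomial ℝ).map (algebraMap ℝ ℂ))).roots
          = Finset.univ.val.map (fun i : Fin (n - 1) => (x i : ℂ)) ∧
        ∀ i, (P : Polynomial ℝ).eval (x i) = w (((F P : Equiv.Perm (Fin (n - 1)))) i)) ∧
      Nat.card (simpleSet n w)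
        = Nat.card {σ : Equiv.Perm (Fin (n - 1)) // IsAlternating n σ} := by
  obtain ⟨k, rfl⟩ : ∃ k, n = k + 2 := ⟨n - 2, by omega⟩
  obtain ⟨F, hF, hF'⟩ := main_aux k w hw
  exact ⟨F, hF, hF', Nat.card_eq_of_bijective F hF⟩
end

section
/- Let P be a real polynomial of even degree n ≥ 2 with positive leading coefficient, and let w = min_{x∈ℝ} P(x) be its minimum value on the real line. Then in the reduced ramification type λ_w of w, every even number appears an even number of times. (Indeed, every real root of P − w has even multiplicity, and the nonreal roots of P − w come in conjugate pairs of equal multiplicity.) -/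
open Polynomial
open scoped Classical

/-- The reduced ramification type: subtract 1 from every part of the ramification type
and delete the zeros. -/
noncomputable def redRamType (P : Polynomial ℝ) (w : ℝ) : Multiset ℕ :=
  ((ramType P w).map fun a => a - 1).filter fun a => a ≠ 0

lemma even_rootMultiplicity_of_nonneg (Q : Polynomial ℝ) (hQ : Q ≠ 0)
    (h : ∀ x, 0 ≤ Q.eval x) (x : ℝ) : Even (Q.rootMultiplicity x) := by
  by_contra hodd
  rw [Nat.not_even_iff_odd] at hodd
  obtain ⟨g, hg, hnd⟩ := Q.exists_eq_pow_rootMultiplicity_mul_and_not_dvd hQ x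
  apply hnd
  rw [Polynomial.dvd_iff_isRoot, Polynomial.IsRoot.def]
  have key : ∀ y, 0 ≤ (y - x) ^ (Q.rootMultiplicity x) * g.eval y := by
    intro y
    have h1 := h y
    rw [hg] at h1
    simpa using h1
  apply le_antisymm
  · have ht : Filter.Tendsto (fun y => g.eval y) (nhdsWithin x (Set.Iio x)) (nhds (g.eval x)) :=
      (g.continuous.tendsto x).mono_left nhdsWithin_le_nhds
    refine le_of_tendsto ht ?_
    filter_upwards [self_mem_nhdsWithin] with y hy
    have hy' : (y - x) ^ (Q.rootMultiplicity x) < 0 := hodd.pow_neg (sub_neg.2 hy)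
    have := key y
    by_contra hc
    push Not at hc
    exact absurd (mul_neg_of_neg_of_pos hy' hc) (not_lt.2 this)
  · have ht : Filter.Tendsto (fun y => g.eval y) (nhdsWithin x (Set.Ioi x)) (nhds (g.eval x)) :=
      (g.continuous.tendsto x).mono_left nhdsWithin_le_nhds
    refine ge_of_tendsto ht ?_
    filter_upwards [self_mem_nhdsWithin] with y hy
    have hy' : 0 < (y - x) ^ (Q.rootMultiplicity x) := pow_pos (sub_pos.2 hy) _
    exact nonneg_of_mul_nonneg_right (key y) hy'

lemma rootMultiplicity_conj (Q : Polynomial ℝ) (z : ℂ) :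
    (Q.map (algebraMap ℝ ℂ)).rootMultiplicity ((starRingEnd ℂ) z)
      = (Q.map (algebraMap ℝ ℂ)).rootMultiplicity z := by
  have h := Polynomial.eq_rootMultiplicity_map (p := Q.map (algebraMap ℝ ℂ))
    (f := starRingEnd ℂ) (starRingEnd ℂ).injective z
  rw [h, Polynomial.map_map]
  congr 2
  ext r
  simp

/-- If `P` is a real polynomial of even degree `n ≥ 2` with positive leading
coefficient and `w` is the minimum value of `P` on the real line, then every even
number appears an even number of times in the reduced ramification type of `w`. -/
theorem minimum_level_even_parts (n : ℕ) (hn : 2 ≤ n) (hneven : Even n)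
    (P : Polynomial ℝ) (hdeg : P.natDegree = n) (hlead : 0 < P.leadingCoeff)
    (w : ℝ) (hw : IsLeast (Set.range fun x : ℝ => P.eval x) w) :
    ∀ a : ℕ, Even a → Even ((redRamType P w).count a) := by
  intro a ha
  have hmap : P.map (algebraMap ℝ ℂ) - Polynomial.C (w : ℂ)
      = (P - Polynomial.C w).map (algebraMap ℝ ℂ) := by simp
  have hQ : P - Polynomial.C w ≠ 0 := by
    intro h0
    have := Polynomial.natDegree_C w
    rw [← sub_eq_zero.1 h0] at this
    omega
  have hnn : ∀ x, 0 ≤ (P - Polynomial.C w).eval x := by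
    intro x
    have := hw.2 ⟨x, rfl⟩
    simpa using this
  unfold redRamType ramType
  rw [hmap]
  generalize P - Polynomial.C w = Q at hQ hnn
  rw [Multiset.count_filter]
  split_ifs with ha0
  swap
  · exact Even.zero
  rw [Multiset.map_map, Multiset.count_map]
  have hcard : Multiset.card (Multiset.filter (fun z => a =
      ((fun a => a - 1) ∘ fun z => (Q.map (algebraMap ℝ ℂ)).rootMultiplicity z) z)
      (Q.map (algebraMap ℝ ℂ)).roots.toFinset.val)
      = ((Q.map (algebraMap ℝ ℂ)).roots.toFinset.filter
        (fun z => a = (Q.map (algebraMap ℝ ℂ)).rootMultiplicity z - 1)).card := rfl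
  rw [hcard, ← ZMod.natCast_eq_zero_iff_even, Finset.card_eq_sum_ones, Nat.cast_sum]
  refine Finset.sum_involution (fun z _ => (starRingEnd ℂ) z) ?_ ?_ ?_ ?_
  · intro z _
    decide
  · intro z hz _ hfix
    rw [Finset.mem_filter] at hz
    obtain ⟨r, rfl⟩ := Complex.conj_eq_iff_real.1 hfix
    have h1 := Polynomial.eq_rootMultiplicity_map (p := Q)
      (f := algebraMap ℝ ℂ) (algebraMap ℝ ℂ).injective r
    have h2 := even_rootMultiplicity_of_nonneg Q hQ hnn r
    have h3 := hz.2
    rw [Complex.coe_algebraMap] at h1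
    change a = Polynomial.rootMultiplicity (r : ℂ) (Q.map (algebraMap ℝ ℂ)) - 1 at h3
    erw [← h1] at h3
    obtain ⟨k, hk⟩ := h2
    obtain ⟨l, hl⟩ := ha
    omega
  · intro z hz
    have hm : Q.map (algebraMap ℝ ℂ) ≠ 0 :=
      (Polynomial.map_ne_zero_iff (algebraMap ℝ ℂ).injective).2 hQ
    simp only [Finset.mem_filter, Multiset.mem_toFinset] at hz ⊢
    rw [← Multiset.count_pos, Polynomial.count_roots] at hz ⊢
    rw [rootMultiplicity_conj]
    exact hz
  · intro z _
    simp
end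

section
/- Let P be a real monic polynomial of odd degree n ≥ 1 and let w ∈ ℝ be such that P(x) ≥ w for every real root x of the derivative P′ (i.e., no real critical value of P is below w). Then P − w has exactly one real root of odd multiplicity, and consequently in the reduced ramification type λ_w of w at most one even number appears an odd number of times. -/
open Polynomial
open scoped Classical

lemma aux_sign (Q : Polynomial ℝ) (hQ : Q ≠ 0) (x : ℝ) :
    ∃ δ > 0, ∀ y₁ y₂ : ℝ, x - δ < y₁ → y₁ < x → x < y₂ → y₂ < x + δ →
      (Odd (Q.rootMultiplicity x) → Q.eval y₁ * Q.eval y₂ < 0) ∧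
      (Even (Q.rootMultiplicity x) → 0 < Q.eval y₁ * Q.eval y₂) := by
  obtain ⟨R, hR, hRd⟩ := Polynomial.exists_eq_pow_rootMultiplicity_mul_and_not_dvd Q hQ x
  generalize Q.rootMultiplicity x = m at *
  have hRx : R.eval x ≠ 0 := fun h => hRd (Polynomial.dvd_iff_isRoot.mpr h)
  have hc : ContinuousAt (fun y => R.eval y * R.eval x) x := by fun_prop
  have hpos : 0 < R.eval x * R.eval x := mul_self_pos.mpr hRx
  have hev := hc.eventually (lt_mem_nhds hpos)
  obtain ⟨δ, hδ, h⟩ := Metric.eventually_nhds_iff.mp hev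
  refine ⟨δ, hδ, fun y₁ y₂ h1 h2 h3 h4 => ?_⟩
  have a1 := h (y := y₁) (by rw [Real.dist_eq, abs_lt]; constructor <;> linarith)
  have a2 := h (y := y₂) (by rw [Real.dist_eq, abs_lt]; constructor <;> linarith)
  have hRR : 0 < R.eval y₁ * R.eval y₂ := by
    have : 0 < (R.eval y₁ * R.eval y₂) * (R.eval x * R.eval x) := by
      have := mul_pos a1 a2
      nlinarith
    exact (pos_iff_pos_of_mul_pos this).mpr hpos
  have e : Q.eval y₁ * Q.eval y₂ =
      ((y₁ - x) ^ m * (y₂ - x) ^ m) * (R.eval y₁ * R.eval y₂) := by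
    rw [hR]; simp; ring
  have p2 : 0 < (y₂ - x) ^ m := pow_pos (by linarith) m
  rw [e]
  constructor
  · intro ho
    have p1 : (y₁ - x) ^ m < 0 := ho.pow_neg (by linarith)
    exact mul_neg_of_neg_of_pos (mul_neg_of_neg_of_pos p1 p2) hRR
  · intro ho
    have p1 : 0 < (y₁ - x) ^ m := ho.pow_pos (by intro h; linarith)
    positivity

lemma aux_exists_sep (n : ℕ) (hnodd : Odd n)
    (Q : Polynomial ℝ) (hdeg : Q.natDegree = n) (hmonic : Q.Monic)
    (hw : ∀ x : ℝ, (Polynomial.derivative Q).eval x = 0 → 0 ≤ Q.eval x) :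
    ∃ x₀ : ℝ, (∀ y < x₀, Q.eval y < 0) ∧ ∀ y > x₀, 0 ≤ Q.eval y := by
  have hn : 0 < n := hnodd.pos
  have hd : 0 < Q.degree := by
    rw [← Polynomial.natDegree_pos_iff_degree_pos, hdeg]; exact hn
  have htop : Filter.Tendsto (fun x => Q.eval x) Filter.atTop Filter.atTop :=
    Polynomial.tendsto_atTop_of_leadingCoeff_nonneg Q hd (by rw [hmonic.leadingCoeff]; norm_num)
  have hbot : ∃ a, Q.eval a < 0 := by
    have hd' : 0 < (Q.comp (-X)).degree := by
      rw [← Polynomial.natDegree_pos_iff_degree_pos, Polynomial.natDegree_comp]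
      simp [hdeg, hn]
    have hl : (Q.comp (-X)).leadingCoeff = -1 := by
      rw [Polynomial.leadingCoeff_comp (by simp)]
      simp [hmonic.leadingCoeff, hdeg, hnodd.neg_one_pow]
    have := Polynomial.tendsto_atBot_of_leadingCoeff_nonpos (Q.comp (-X)) hd'
      (by rw [hl]; norm_num)
    obtain ⟨b, hb⟩ := (this.eventually (Filter.eventually_lt_atBot 0)).exists
    exact ⟨-b, by simpa using hb⟩
  have hdown : ∀ a, Q.eval a < 0 → ∀ y < a, Q.eval y < 0 := by
    intro a ha y hy
    by_contra! hy0
    obtain ⟨b, hb, hab⟩ := ((htop.eventually (Filter.eventually_ge_atTop 0)).and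
      (Filter.eventually_gt_atTop a)).exists
    obtain ⟨c, hc, hmin⟩ := isCompact_Icc.exists_isMinOn (s := Set.Icc y b)
      ⟨a, hy.le, hab.le⟩ (f := fun x => Q.eval x) (by fun_prop)
    have hca : Q.eval c ≤ Q.eval a := hmin ⟨hy.le, hab.le⟩
    have h1 : y < c := lt_of_le_of_ne hc.1 (by rintro rfl; linarith)
    have h2 : c < b := lt_of_le_of_ne hc.2 (by rintro rfl; linarith)
    have hloc := hmin.isLocalMin (Icc_mem_nhds h1 h2)
    have := hw c (hloc.hasDerivAt_eq_zero (Q.hasDerivAt c))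
    linarith
  obtain ⟨a, ha⟩ := hbot
  obtain ⟨b, hb⟩ := (htop.eventually (Filter.eventually_ge_atTop 0)).exists
  have hbdd : BddAbove {y | Q.eval y < 0} := by
    refine ⟨b, fun y hy => ?_⟩
    by_contra! h
    have := hdown y hy b h
    linarith
  refine ⟨sSup {y | Q.eval y < 0}, fun y hy => ?_, fun y hy => ?_⟩
  · obtain ⟨z, hz, hyz⟩ := exists_lt_of_lt_csSup ⟨a, ha⟩ hy
    exact hdown z hz y hyz
  · by_contra! h
    have := le_csSup hbdd h
    linarith

lemma aux_count (Q : Polynomial ℝ) (hQ : Q ≠ 0) (a : ℕ)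
    (hno : ∀ x : ℝ, Q.rootMultiplicity x ≠ a + 1) :
    Even (((Q.map (algebraMap ℝ ℂ)).roots.toFinset.filter
      fun z => (Q.map (algebraMap ℝ ℂ)).rootMultiplicity z = a + 1).card) := by
  set S := (Q.map (algebraMap ℝ ℂ)) with hS
  have hS0 : S ≠ 0 := (Polynomial.map_ne_zero_iff (algebraMap ℝ ℂ).injective).mpr hQ
  have hconj : ∀ z : ℂ, S.rootMultiplicity (starRingEnd ℂ z) = S.rootMultiplicity z := by
    intro z
    have h := Polynomial.eq_rootMultiplicity_map (p := S) (f := starRingEnd ℂ)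
      (starRingEnd ℂ).injective z
    have hm : S.map (starRingEnd ℂ) = S := by
      rw [hS, Polynomial.map_map]
      congr 1
      ext x
      simp
    rw [hm] at h
    exact h.symm
  rw [← ZMod.natCast_eq_zero_iff_even, Finset.cast_card]
  refine Finset.sum_involution (fun z _ => starRingEnd ℂ z) ?_ ?_ ?_ ?_
  · intros; decide
  · intro z hz _ hzz
    obtain ⟨r, rfl⟩ := Complex.conj_eq_iff_real.mp hzz
    have h := Polynomial.eq_rootMultiplicity_map (p := Q) (f := algebraMap ℝ ℂ)
      (algebraMap ℝ ℂ).injective r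
    exact hno r (h.trans (Finset.mem_filter.mp hz).2)
  · intro z hz
    have hz2 := (Finset.mem_filter.mp hz).2
    rw [Finset.mem_filter, hconj, Multiset.mem_toFinset, Polynomial.mem_roots hS0,
      ← Polynomial.rootMultiplicity_pos hS0, hconj]
    exact ⟨by omega, hz2⟩
  · intro z hz
    simp

/-- If `P` is a real monic polynomial of odd degree `n ≥ 1` and no real critical value
of `P` is below `w`, then `P - w` has exactly one real root of odd multiplicity, and in
the reduced ramification type of `w` at most one even number appears an odd number of
times. -/
theorem lowest_level_odd_degree (n : ℕ) (hn : 1 ≤ n) (hnodd : Odd n)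
    (P : Polynomial ℝ) (hdeg : P.natDegree = n) (hmonic : P.Monic)
    (w : ℝ) (hw : ∀ x : ℝ, (Polynomial.derivative P).eval x = 0 → w ≤ P.eval x) :
    (∃! x : ℝ, Odd ((P - Polynomial.C w).rootMultiplicity x)) ∧
      ({a : ℕ | Even a ∧ Odd ((redRamType P w).count a)} : Set ℕ).Subsingleton := by
  have hQdeg : (P - C w).natDegree = n := by simp [hdeg]
  have hQm : (P - C w).Monic := by
    apply hmonic.sub_of_left
    refine lt_of_le_of_lt Polynomial.degree_C_le ?_
    rw [← Polynomial.natDegree_pos_iff_degree_pos]; omega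
  have hQ0 := hQm.ne_zero
  have huniq : ∃! x : ℝ, Odd ((P - Polynomial.C w).rootMultiplicity x) := by
    obtain ⟨x₀, hneg, hpos⟩ := aux_exists_sep n hnodd (P - C w) hQdeg hQm (by
      intro x hx
      have := hw x (by simpa using hx)
      simpa using this)
    refine ⟨x₀, ?_, ?_⟩
    · obtain ⟨δ, hδ, h⟩ := aux_sign _ hQ0 x₀
      have h' := (h (x₀ - δ/2) (x₀ + δ/2) (by linarith) (by linarith) (by linarith)
        (by linarith)).2
      change Odd _
      rw [← Nat.not_even_iff_odd]
      intro he
      have a1 := hneg (x₀ - δ/2) (by linarith)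
      have a2 := hpos (x₀ + δ/2) (by linarith)
      have := h' he
      nlinarith
    · intro x hx
      obtain ⟨δ, hδ, h⟩ := aux_sign _ hQ0 x
      rcases lt_trichotomy x x₀ with hlt | heq | hgt
      · exfalso
        obtain ⟨y₂, hy1, hy2⟩ := exists_between (show x < min x₀ (x + δ) by
          rw [lt_min_iff]; constructor <;> linarith)
        rw [lt_min_iff] at hy2
        have h' := (h (x - δ/2) y₂ (by linarith) (by linarith) hy1 hy2.2).1 hx
        have a1 := hneg (x - δ/2) (by linarith)
        have a2 := hneg y₂ hy2.1
        nlinarith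
      · exact heq
      · exfalso
        obtain ⟨y₁, hy1, hy2⟩ := exists_between (show max x₀ (x - δ) < x by
          rw [max_lt_iff]; constructor <;> linarith)
        rw [max_lt_iff] at hy1
        have h' := (h y₁ (x + δ/2) hy1.2 hy2 (by linarith) (by linarith)).1 hx
        have a1 := hpos (x + δ/2) (by linarith)
        have a2 := hpos y₁ hy1.1
        nlinarith
  refine ⟨huniq, ?_⟩
  have key : ∀ a : ℕ, Even a → Odd ((redRamType P w).count a) →
      ∃ x : ℝ, (P - C w).rootMultiplicity x = a + 1 := by
    intro a _ ha
    by_contra! hno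
    have hcount := aux_count (P - C w) hQ0 a hno
    have hmap : (P - C w).map (algebraMap ℝ ℂ) = P.map (algebraMap ℝ ℂ) - C (w : ℂ) := by
      simp
    rw [hmap] at hcount
    have ha0 : a ≠ 0 := by
      rintro rfl
      rw [redRamType, Multiset.count_filter_of_neg (by simp)] at ha
      simp at ha
    rw [redRamType, Multiset.count_filter_of_pos (p := fun a => a ≠ 0) ha0, ramType, Multiset.map_map,
      Multiset.count_map, ← Nat.not_even_iff_odd] at ha
    apply ha
    convert hcount using 1
    rw [Finset.card_def, Finset.filter_val]
    congr 1
    apply Multiset.filter_congr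
    intro z _
    simp only [Function.comp]
    omega
  rintro a ⟨hae, hao⟩ b ⟨hbe, hbo⟩
  obtain ⟨x, hx⟩ := key a hae hao
  obtain ⟨y, hy⟩ := key b hbe hbo
  have hxy : x = y := huniq.unique (by rw [hx]; exact hae.add_one) (by rw [hy]; exact hbe.add_one)
  subst hxy
  omega
end

section
/- For every n ≥ 1 and every finite set W ⊂ ℝ, the set of normalized real polynomials P of degree n such that every complex critical value of P lies in W (i.e., P(z) ∈ W for every complex root z of the derivative P′) is finite. -/
open Polynomial
open scoped Classical

theorem hc_mul {σ : Type*} (N d : ℕ) (g f : MvPolynomial σ ℂ) (hf : f.IsHomogeneous d) :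
    MvPolynomial.homogeneousComponent N (g * f) =
      if d ≤ N then MvPolynomial.homogeneousComponent (N - d) g * f else 0 := by
  let _ : GradedAlgebra (MvPolynomial.homogeneousSubmodule σ ℂ) := MvPolynomial.gradedAlgebra
  have := DirectSum.coe_decompose_mul_of_right_mem (𝒜 := MvPolynomial.homogeneousSubmodule σ ℂ)
    N (a := g) (b := f) (i := d) hf
  have e : ∀ (p : MvPolynomial σ ℂ) (i : ℕ),
      ((DirectSum.decompose (MvPolynomial.homogeneousSubmodule σ ℂ) p) i : MvPolynomial σ ℂ) =
        MvPolynomial.homogeneousComponent i p :=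
    fun p i => MvPolynomial.decomposition.decompose'_apply p i
  rwa [e, e] at this

theorem exists_pow_eq {σ ι : Type*} [Finite σ] [Fintype ι] (f : ι → MvPolynomial σ ℂ)
    (d : ι → ℕ) (hd : ∀ i, 0 < d i) (hf : ∀ i, (f i).IsHomogeneous (d i))
    (h0 : ∀ x : σ → ℂ, (∀ i, MvPolynomial.eval x (f i) = 0) → x = 0) (j : σ) :
    ∃ (N : ℕ) (g : ι → MvPolynomial σ ℂ),
      (MvPolynomial.X j : MvPolynomial σ ℂ) ^ (N + 1) = ∑ i, g i * f i ∧
      ∀ i, (g i).totalDegree ≤ N := by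
  have h1 : (MvPolynomial.X j : MvPolynomial σ ℂ) ∈ (Ideal.span (Set.range f)).radical := by
    rw [← MvPolynomial.vanishingIdeal_zeroLocus_eq_radical (K := ℂ)]
    rw [MvPolynomial.mem_vanishingIdeal_iff]
    intro x hx
    rw [MvPolynomial.mem_zeroLocus_iff] at hx
    have : x = 0 := h0 x fun i => by
      have := hx (f i) (Ideal.subset_span ⟨i, rfl⟩)
      simpa [MvPolynomial.aeval_eq_eval] using this
    simp [this]
  obtain ⟨N, hN⟩ := h1
  have h2 : (MvPolynomial.X j : MvPolynomial σ ℂ) ^ (N + 1) ∈ Ideal.span (Set.range f) := by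
    rw [pow_succ]
    exact Ideal.mul_mem_right _ _ hN
  obtain ⟨c, hc⟩ := (Ideal.mem_span_range_iff_exists_fun).1 h2
  refine ⟨N, fun i => if d i ≤ N + 1 then
    MvPolynomial.homogeneousComponent (N + 1 - d i) (c i) else 0, ?_, ?_⟩
  · have h3 := congrArg (MvPolynomial.homogeneousComponent (N + 1)) hc
    rw [MvPolynomial.homogeneousComponent_eq_self (MvPolynomial.isHomogeneous_X_pow j (N+1)),
      map_sum] at h3
    rw [← h3]
    refine Finset.sum_congr rfl fun i _ => ?_
    rw [hc_mul _ _ _ _ (hf i)]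
    dsimp only
    split_ifs with h
    · rfl
    · rw [zero_mul]
  · intro i
    have := hd i
    dsimp only
    split_ifs with h
    · exact (MvPolynomial.homogeneousComponent_isHomogeneous _ _).totalDegree_le.trans (by omega)
    · simp

theorem fin_fibre {σ ι : Type*} [Fintype σ] [Fintype ι] (f : ι → MvPolynomial σ ℂ)
    (d : ι → ℕ) (hd : ∀ i, 0 < d i) (hf : ∀ i, (f i).IsHomogeneous (d i))
    (h0 : ∀ x : σ → ℂ, (∀ i, MvPolynomial.eval x (f i) = 0) → x = 0) (w : ι → ℂ) :
    {x : σ → ℂ | ∀ i, MvPolynomial.eval x (f i) = w i}.Finite := by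
  set S := {x : σ → ℂ | ∀ i, MvPolynomial.eval x (f i) = w i} with hS
  choose N g hg hgd using exists_pow_eq f d hd hf h0
  let φ : MvPolynomial σ ℂ →ₐ[ℂ] (S → ℂ) := MvPolynomial.aeval (fun j x => x.1 j)
  have hφ : ∀ p (x : S), φ p x = MvPolynomial.eval x.1 p := by
    intro p x
    induction p using MvPolynomial.induction_on with
    | C a => simp [φ]
    | add p q hp hq => simp [hp, hq]
    | mul_X p i hp => simp [hp]; simp [φ]
  set D := ∑ j, (N j + 1) with hD
  let T : Submodule ℂ (S → ℂ) := (MvPolynomial.restrictTotalDegree σ ℂ D).map φ.toLinearMap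
  have key : ∀ k (p : MvPolynomial σ ℂ), p.totalDegree ≤ k → φ p ∈ T := by
    intro k
    have triv : ∀ p : MvPolynomial σ ℂ, p.totalDegree ≤ D → φ p ∈ T := fun p hp =>
      ⟨p, (MvPolynomial.mem_restrictTotalDegree _ _ _).2 hp, rfl⟩
    induction k with
    | zero => exact fun p hp => triv p (by omega)
    | succ k ih =>
      intro p hp
      rw [p.as_sum, map_sum]
      refine Submodule.sum_mem _ fun m hm => ?_
      have hmd : m.degree ≤ k + 1 := by
        have := (MvPolynomial.le_totalDegree hm).trans hp
        rwa [Finsupp.degree_eq_sum, ← Finsupp.sum_fintype m (fun _ e => e) (fun _ => rfl)]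
      generalize p.coeff m = a
      by_cases hmD : m.degree ≤ D
      · exact triv _ ((MvPolynomial.isHomogeneous_monomial a rfl).totalDegree_le.trans hmD)
      have : ∃ j, N j + 1 ≤ m j := by
        by_contra! hcon
        apply hmD
        rw [Finsupp.degree_eq_sum]
        exact Finset.sum_le_sum fun j _ => (hcon j).le
      obtain ⟨j, hj⟩ := this
      set m' := m - Finsupp.single j (N j + 1) with hm'
      have hmm : m = Finsupp.single j (N j + 1) + m' := by
        rw [hm', add_tsub_cancel_of_le]
        exact Finsupp.single_le_iff.2 hj
      have hdeg : m.degree = N j + 1 + m'.degree := by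
        conv_lhs => rw [hmm]
        simp
      have e1 : MvPolynomial.monomial m a =
          (MvPolynomial.X j) ^ (N j + 1) * MvPolynomial.monomial m' a := by
        rw [MvPolynomial.X_pow_eq_monomial, MvPolynomial.monomial_mul, ← hmm, one_mul]
      have e2 : φ (MvPolynomial.monomial m a) =
          φ (∑ i, MvPolynomial.C (w i) * (g j i * MvPolynomial.monomial m' a)) := by
        funext x
        rw [hφ, hφ, e1, hg, map_mul, map_sum, map_sum, Finset.sum_mul]
        refine Finset.sum_congr rfl fun i _ => ?_
        have := x.2 i
        simp only [map_mul, MvPolynomial.eval_C, this]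
        ring
      rw [e2]
      apply ih
      refine MvPolynomial.totalDegree_finsetSum_le fun i _ => ?_
      refine (MvPolynomial.totalDegree_mul _ _).trans ?_
      rw [MvPolynomial.totalDegree_C, zero_add]
      refine (MvPolynomial.totalDegree_mul _ _).trans ?_
      have h1 := hgd j i
      have h2 := (MvPolynomial.isHomogeneous_monomial a (rfl : m'.degree = _)).totalDegree_le
      omega
  have hTfg : T.FG := Submodule.FG.map _ (Module.Finite.iff_fg.1 inferInstance)
  have hT : Subalgebra.toSubmodule φ.range = T := by
    apply le_antisymm
    · rintro _ ⟨p, rfl⟩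
      exact key _ p le_rfl
    · rintro _ ⟨p, _, rfl⟩
      exact ⟨p, rfl⟩
  have hint : ∀ j, ∃ p : ℂ[X], p.Monic ∧ ∀ x ∈ S, p.eval (x j) = 0 := by
    intro j
    obtain ⟨p, hp, hp0⟩ := IsIntegral.of_mem_of_fg φ.range (hT ▸ hTfg) (φ (MvPolynomial.X j)) ⟨_, rfl⟩
    refine ⟨p, hp, fun x hx => ?_⟩
    have h1 := congrFun hp0 ⟨x, hx⟩
    rw [← Polynomial.aeval_def, Polynomial.aeval_fn_apply] at h1
    simpa [φ] using h1
  choose p hp hp0 using hint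
  refine (Set.Finite.pi (t := fun j => {z | z ∈ (p j).roots.toFinset}) fun j =>
    Finset.finite_toSet _).subset ?_
  intro x hx j _
  simp [hp0 j x hx, (hp j).ne_zero]

theorem coeff_prod_hom {σ ι : Type*} (s : Finset ι) (v : ι → MvPolynomial σ ℂ)
    (hv : ∀ i, (v i).IsHomogeneous 1) :
    ∀ k m, m + k = s.card → ((∏ i ∈ s, (X - C (v i))).coeff k).IsHomogeneous m := by
  induction s using Finset.induction_on with
  | empty =>
    intro k m h
    simp only [Finset.card_empty] at h
    obtain ⟨rfl, rfl⟩ : m = 0 ∧ k = 0 := by omega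
    simpa using MvPolynomial.isHomogeneous_one σ ℂ
  | insert a s ha ih =>
    intro k m h
    rw [Finset.card_insert_of_notMem ha] at h
    rw [Finset.prod_insert ha, sub_mul, coeff_sub, coeff_C_mul]
    refine MvPolynomial.IsHomogeneous.sub ?_ ?_
    · cases k with
      | zero => simpa using MvPolynomial.isHomogeneous_zero σ ℂ m
      | succ k => rw [coeff_X_mul]; exact ih k m (by omega)
    · cases m with
      | zero =>
        rw [coeff_eq_zero_of_natDegree_lt, mul_zero]
        · exact MvPolynomial.isHomogeneous_zero σ ℂ 0
        · rw [natDegree_finsetProd_X_sub_C_eq_card]; omega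
      | succ m =>
        rw [add_comm m 1]
        exact (hv a).mul (ih k m (by omega))

theorem all_eq {m : ℕ} (r : Fin (m + 1) → ℂ) (c : Fin m → ℂ)
    (h1 : derivative (∏ i, (X - C (r i))) = C ((m : ℂ) + 1) * ∏ j, (X - C (c j)))
    (h2 : ∑ i, r i = 0) (h3 : ∀ j, ∏ i, (c j - r i) = 0) : r = 0 ∧ c = 0 := by
  set P : ℂ[X] := ∏ i, (X - C (r i)) with hP
  have hm : (m : ℂ) + 1 ≠ 0 := by exact_mod_cast Nat.succ_ne_zero m
  have hPm : P.Monic := monic_prod_of_monic _ _ fun i _ => monic_X_sub_C _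
  have hr : P.roots = Finset.univ.val.map r := by
    have := roots_multiset_prod_X_sub_C (Finset.univ.val.map r)
    rwa [Multiset.map_map] at this
  have hc : (derivative P).roots = Finset.univ.val.map c := by
    have := roots_multiset_prod_X_sub_C (Finset.univ.val.map c)
    rw [Multiset.map_map] at this
    rw [h1, roots_C_mul _ hm]
    exact this
  have hcr : ∀ j, c j ∈ P.roots.toFinset := by
    intro j
    rw [Multiset.mem_toFinset, mem_roots hPm.ne_zero, IsRoot.def, hP, eval_prod]
    simpa using h3 j
  have s1 : ∑ a ∈ P.roots.toFinset, P.roots.count a = m + 1 := by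
    rw [Multiset.toFinset_sum_count_eq, hr]; simp
  have s2 : ∑ a ∈ P.roots.toFinset, (derivative P).roots.count a = m := by
    rw [Multiset.sum_count_eq_card, hc]
    · simp
    · rw [hc]
      intro a ha
      obtain ⟨j, _, rfl⟩ := Multiset.mem_map.1 ha
      exact hcr j
  have s3 : ∑ a ∈ P.roots.toFinset, P.roots.count a =
      ∑ a ∈ P.roots.toFinset, ((derivative P).roots.count a + 1) := by
    refine Finset.sum_congr rfl fun a ha => ?_
    have ha' : a ∈ P.roots := Multiset.mem_toFinset.1 ha
    have hroot := (mem_roots hPm.ne_zero).1 ha'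
    have := derivative_rootMultiplicity_of_root hroot
    have h4 := (rootMultiplicity_pos hPm.ne_zero).2 hroot
    rw [count_roots, count_roots, this]
    omega
  rw [Finset.sum_add_distrib, s1, s2, Finset.sum_const, smul_eq_mul, mul_one] at s3
  have s4 : P.roots.toFinset.card = 1 := by omega
  obtain ⟨a, ha⟩ := Finset.card_eq_one.1 s4
  have hra : ∀ i, r i = a := by
    intro i
    have : r i ∈ P.roots.toFinset := by
      rw [Multiset.mem_toFinset, hr]
      exact Multiset.mem_map_of_mem _ (Finset.mem_univ_val _)
    rw [ha] at this
    exact Finset.mem_singleton.1 this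
  have ha0 : a = 0 := by
    simp only [hra, Finset.sum_const, Finset.card_univ, Fintype.card_fin, nsmul_eq_mul] at h2
    push_cast at h2
    exact (mul_eq_zero.1 h2).resolve_left hm
  refine ⟨funext fun i => (hra i).trans ha0, funext fun j => ?_⟩
  have := hcr j
  rw [ha] at this
  exact (Finset.mem_singleton.1 this).trans ha0

theorem deriv_eq_of_coeff {m : ℕ} (r : Fin (m + 1) → ℂ) (c : Fin m → ℂ)
    (h : ∀ k : Fin m, (derivative (∏ i, (X - C (r i))) -
      C ((m : ℂ) + 1) * ∏ j, (X - C (c j))).coeff k = 0) :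
    derivative (∏ i, (X - C (r i))) = C ((m : ℂ) + 1) * ∏ j, (X - C (c j)) := by
  rw [← sub_eq_zero]
  ext k
  rw [coeff_zero]
  have d1 : (∏ i, (X - C (r i))).natDegree = m + 1 := by
    rw [natDegree_finsetProd_X_sub_C_eq_card]; simp
  have d2 : (∏ i, (X - C (c i))).natDegree = m := by
    rw [natDegree_finsetProd_X_sub_C_eq_card]; simp
  have m1 : (∏ i, (X - C (r i))).Monic := monic_prod_of_monic _ _ fun i _ => monic_X_sub_C _
  have m2 : (∏ i, (X - C (c i))).Monic := monic_prod_of_monic _ _ fun i _ => monic_X_sub_C _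
  rcases lt_trichotomy k m with hk | rfl | hk
  · exact h ⟨k, hk⟩
  · have e1 := m1.coeff_natDegree
    have e2 := m2.coeff_natDegree
    rw [d1] at e1
    rw [d2] at e2
    rw [coeff_sub, coeff_derivative, coeff_C_mul, e1, e2]
    ring
  · rw [coeff_sub, coeff_derivative, coeff_C_mul, coeff_eq_zero_of_natDegree_lt (by omega),
      coeff_eq_zero_of_natDegree_lt (by omega)]
    ring

theorem fin_tuples (m : ℕ) (w : Fin m → ℂ) :
    {x : Fin (m + 1) ⊕ Fin m → ℂ |
      derivative (∏ i, (X - C (x (Sum.inl i)))) =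
        C ((m : ℂ) + 1) * ∏ j, (X - C (x (Sum.inr j))) ∧
      ∑ i, x (Sum.inl i) = 0 ∧
      ∀ j, ∏ i, (x (Sum.inr j) - x (Sum.inl i)) = w j}.Finite := by
  let A := MvPolynomial (Fin (m + 1) ⊕ Fin m) ℂ
  let R : A[X] := derivative (∏ i : Fin (m + 1), (X - C (MvPolynomial.X (Sum.inl i) : A))) -
    C (MvPolynomial.C ((m : ℂ) + 1)) * ∏ j : Fin m, (X - C (MvPolynomial.X (Sum.inr j) : A))
  have hR : ∀ (x : Fin (m + 1) ⊕ Fin m → ℂ) k, MvPolynomial.eval x (R.coeff k) =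
      (derivative (∏ i, (X - C (x (Sum.inl i)))) -
        C ((m : ℂ) + 1) * ∏ j, (X - C (x (Sum.inr j)))).coeff k := by
    intro x k
    rw [← coeff_map]
    congr 1
    simp only [R, Polynomial.map_sub, Polynomial.map_mul, ← derivative_map, Polynomial.map_prod,
      map_X, map_C, MvPolynomial.eval_X, MvPolynomial.eval_C]
  let f : Fin m ⊕ (Unit ⊕ Fin m) → A := Sum.elim (fun k => R.coeff k)
    (Sum.elim (fun _ => ∑ i, MvPolynomial.X (Sum.inl i))
      (fun j => ∏ i, (MvPolynomial.X (Sum.inr j) - MvPolynomial.X (Sum.inl i))))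
  let d : Fin m ⊕ (Unit ⊕ Fin m) → ℕ := Sum.elim (fun k => m - k)
    (Sum.elim (fun _ => 1) (fun _ => m + 1))
  have := fin_fibre f d ?_ ?_ ?_ (Sum.elim (fun _ => 0) (Sum.elim (fun _ => 0) w))
  · refine this.subset ?_
    rintro x ⟨h1, h2, h3⟩
    rintro (k | _ | j)
    · simp only [f, Sum.elim_inl, hR, h1, sub_self, coeff_zero]
    · simpa [f] using h2
    · simpa [f, MvPolynomial.eval_prod] using h3 j
  · rintro (k | _ | j)
    · have := k.2
      simp [d]
    · simp [d]
    · simp [d]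
  · rintro (k | _ | j)
    · have hk := k.2
      change (R.coeff k).IsHomogeneous (m - k)
      rw [coeff_sub, coeff_derivative, coeff_C_mul]
      refine MvPolynomial.IsHomogeneous.sub ?_ ?_
      · have h1 := coeff_prod_hom (Finset.univ : Finset (Fin (m + 1)))
          (fun i => (MvPolynomial.X (Sum.inl i) : A)) (fun i => MvPolynomial.isHomogeneous_X _ _)
          (k + 1) (m - k) (by simp; omega)
        have h2 := h1.C_mul ((k : ℂ) + 1)
        rw [mul_comm] at h2
        simpa using h2
      · exact (coeff_prod_hom (Finset.univ : Finset (Fin m))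
          (fun i => (MvPolynomial.X (Sum.inr i) : A)) (fun i => MvPolynomial.isHomogeneous_X _ _)
          k (m - k) (by simp)).C_mul _
    · exact MvPolynomial.IsHomogeneous.sum (Finset.univ : Finset (Fin (m + 1)))
        (fun i => (MvPolynomial.X (Sum.inl i) : A)) 1 fun i _ => MvPolynomial.isHomogeneous_X ℂ _
    · have := MvPolynomial.IsHomogeneous.prod (Finset.univ : Finset (Fin (m + 1)))
        (fun i => (MvPolynomial.X (Sum.inr j) - MvPolynomial.X (Sum.inl i) : A)) (fun _ => 1)
        (fun i _ => (MvPolynomial.isHomogeneous_X ℂ _).sub (MvPolynomial.isHomogeneous_X ℂ _))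
      simpa [f, d] using this
  · intro x hx
    have h1 := deriv_eq_of_coeff (fun i => x (Sum.inl i)) (fun j => x (Sum.inr j)) fun k => by
      rw [← hR]; exact hx (Sum.inl k)
    have h2 : ∑ i, x (Sum.inl i) = 0 := by simpa [f] using hx (Sum.inr (Sum.inl ()))
    have h3 : ∀ j, ∏ i, (x (Sum.inr j) - x (Sum.inl i)) = 0 := fun j => by
      have := hx (Sum.inr (Sum.inr j))
      simpa [f, MvPolynomial.eval_prod] using this
    obtain ⟨e1, e2⟩ := all_eq _ _ h1 h2 h3
    funext i
    rcases i with i | j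
    · exact congrFun e1 i
    · exact congrFun e2 j

theorem exists_tuple (k : ℕ) (Q : ℂ[X]) (hQ : Q.natDegree = k) :
    ∃ r : Fin k → ℂ, Q = C Q.leadingCoeff * ∏ i, (X - C (r i)) := by
  have hs := IsAlgClosed.splits Q
  have hcard : Q.roots.toList.length = k := by
    rw [Multiset.length_toList, ← hs.natDegree_eq_card_roots, hQ]
  subst hcard
  refine ⟨fun i => Q.roots.toList.get i, ?_⟩
  conv_lhs => rw [hs.eq_prod_roots]
  congr 1
  conv_lhs => rw [← Multiset.coe_toList Q.roots]
  rw [Multiset.map_coe, Multiset.prod_coe, ← List.prod_ofFn]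
  congr 1
  conv_lhs => rw [← List.ofFn_get Q.roots.toList]
  rw [List.map_ofFn]
  rfl

/-- For every `n ≥ 1` and every finite set `W ⊂ ℝ`, the set of normalized real
polynomials of degree `n` all of whose complex critical values lie in `W` is finite. -/
theorem finitely_many_polynomials_with_given_critical_values (n : ℕ) (hn : 1 ≤ n)
    (W : Finset ℝ) :
    {P : Polynomial ℝ | IsNormalized n P ∧
      ∀ z : ℂ, (Polynomial.derivative (P.map (algebraMap ℝ ℂ))).eval z = 0 →
        ∃ w ∈ W, (P.map (algebraMap ℝ ℂ)).eval z = (w : ℂ)}.Finite := by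
  obtain ⟨m, rfl⟩ : ∃ m, n = m + 1 := ⟨n - 1, by omega⟩
  have hU := Set.finite_iUnion fun w : Fin m → W => fin_tuples m (fun j => ((w j : ℝ) : ℂ))
  have hV := (hU.image (fun x => ∏ i, (X - C (x (Sum.inl i))))).preimage
    (f := fun P : ℝ[X] => P.map (algebraMap ℝ ℂ))
    (Polynomial.map_injective _ (algebraMap ℝ ℂ).injective).injOn
  refine hV.subset ?_
  rintro P ⟨⟨hdeg, hmon, hco⟩, hcrit⟩
  have hQm : (P.map (algebraMap ℝ ℂ)).Monic := hmon.map _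
  have hQd : (P.map (algebraMap ℝ ℂ)).natDegree = m + 1 := by rw [hmon.natDegree_map, hdeg]
  have hQc : (P.map (algebraMap ℝ ℂ)).coeff m = 0 := by
    rw [coeff_map]
    simp only [Nat.add_sub_cancel] at hco
    rw [hco, map_zero]
  rw [Set.mem_preimage]
  revert hcrit hQm hQd hQc
  generalize P.map (algebraMap ℝ ℂ) = Q
  intro hcrit hQm hQd hQc
  have hm : (m : ℂ) + 1 ≠ 0 := by exact_mod_cast Nat.succ_ne_zero m
  have hdd : (derivative Q).natDegree = m := by
    rw [natDegree_derivative, hQd]; simp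
  have hdl : (derivative Q).leadingCoeff = (m : ℂ) + 1 := by
    have := hQm.coeff_natDegree
    rw [hQd] at this
    rw [leadingCoeff, hdd, coeff_derivative, this, one_mul]
  obtain ⟨r, hr⟩ := exists_tuple (m + 1) Q hQd
  obtain ⟨c, hc⟩ := exists_tuple m (derivative Q) hdd
  rw [hQm.leadingCoeff, C_1, one_mul] at hr
  rw [hdl] at hc
  have hcr : ∀ j, (derivative Q).eval (c j) = 0 := by
    intro j
    rw [hc, eval_mul, eval_prod, Finset.prod_eq_zero (Finset.mem_univ j) (by simp), mul_zero]
  choose w hw hw2 using fun j => hcrit (c j) (hcr j)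
  refine ⟨Sum.elim r c, ?_, hr.symm⟩
  rw [Set.mem_iUnion]
  refine ⟨fun j => ⟨w j, hw j⟩, ?_, ?_, ?_⟩
  · simp only [Sum.elim_inl, Sum.elim_inr]
    rw [← hr, ← hc]
  · have h := prod_X_sub_C_nextCoeff (s := Finset.univ) r
    rw [← hr, nextCoeff_of_natDegree_pos (by omega), hQd, Nat.add_sub_cancel, hQc] at h
    simpa using h.symm
  · intro j
    have := hw2 j
    rw [hr, eval_prod] at this
    simpa using this
end
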